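/- arXiv:1301.2445 — 3 statements merged into one kernel-verified Lean document; each statement's English description precedes it below -/
import Mathlib

section
/- Let v ≥ 7 and for r = 1, 2 let S_r ⊆ Z_v satisfy |S_r| = 3 and |S_r − S_r| = 7 (so that S_r is a base line of a cyclic configuration of type (v_3)). Then Conf(Z_v, S₁) and Conf(Z_v, S₂) are isomorphic if and only if they are multiplier equivalent, i.e., if and only if there exist a unit a ∈ Z_v* and b ∈ Z_v such that S₁ = aS₂ + b. -/
open scoped Pointwise

/-- The line set of the cyclic configuration `Conf(Z_v, S)`: the translates `S + i`. -/
def confLines (v : ℕ) (S : Finset (ZMod v)) : Set (Finset (ZMod v)) :=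
  {B | ∃ i : ZMod v, B = S.image (· + i)}

/-- Two cyclic configurations are isomorphic if some bijection of `ZMod v` maps the
line set of the first onto the line set of the second. -/
def ConfIso (v : ℕ) (S₁ S₂ : Finset (ZMod v)) : Prop :=
  ∃ σ : Equiv.Perm (ZMod v),
    (fun B : Finset (ZMod v) => B.image σ) '' confLines v S₁ = confLines v S₂

/-- Multiplier equivalence: `S₁ = a S₂ + b` for a unit `a` and some `b`. -/
def MultEquiv (v : ℕ) (S₁ S₂ : Finset (ZMod v)) : Prop :=
  ∃ a : (ZMod v)ˣ, ∃ b : ZMod v, S₁ = S₂.image (fun x => (a : ZMod v) * x + b)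

/-- The nonzero differences of `S`: the connection set of the collinearity graph of the
configuration with base line `S`. -/
def diffs {R : Type*} [AddGroup R] [DecidableEq R] (S : Finset R) : Finset R := (S - S).erase 0

/-- `D` consists of the six distinct nonzero elements `±x, ±y, ±z`, where `x + y + z = 0`. -/
structure IsHexagon {R : Type*} [CommRing R] (D : Finset R) (x y z : R) : Prop where
  sum_eq_zero : x + y + z = 0
  mem_iff : ∀ t, t ∈ D ↔ t = x ∨ t = -x ∨ t = y ∨ t = -y ∨ t = z ∨ t = -z
  nodup : [0, x, -x, y, -y, z, -z].Nodup

section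
variable {R : Type*} [CommRing R] {D S : Finset R} {d x y z : R}

lemma IsHexagon.ne (h : IsHexagon D x y z) :
    x ≠ 0 ∧ y ≠ 0 ∧ z ≠ 0 ∧ 2 * x ≠ 0 ∧ 2 * y ≠ 0 ∧ 2 * z ≠ 0 ∧ x ≠ y ∧ y ≠ z ∧ x ≠ z := by
  have := h.nodup
  simp only [List.nodup_cons, List.mem_cons, not_or] at this
  grind

/-- A map whose increments along a set `D` are translation invariant is affine on the subgroup
generated by `D`. -/
lemma map_add_of_mem_closure {D : Set R} {f : R → R}
    (hf : ∀ x, ∀ d ∈ D, ∀ e ∈ D, f (x + d + e) - f (x + d) = f (x + e) - f x) {h k : R}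
    (hh : h ∈ AddSubgroup.closure D) (hk : k ∈ AddSubgroup.closure D) :
    f (k + h) - f k = f h - f 0 := by
  have h1 : ∀ k ∈ AddSubgroup.closure D, ∀ x, ∀ e ∈ D,
      f (x + k + e) - f (x + k) = f (x + e) - f x := by
    intro k hk
    induction hk using AddSubgroup.closure_induction with
    | mem d hd => exact fun x e he => hf x d hd e he
    | zero => simp
    | add a b _ _ iha ihb =>
      intro x e he
      rw [← add_assoc, ihb _ e he, iha _ e he]
    | neg a _ ih =>
      intro x e he
      rw [← ih (x + -a) e he, neg_add_cancel_right]
  have h2 : ∀ x, ∀ k ∈ AddSubgroup.closure D, f (x + k + h) - f (x + k) = f (x + h) - f x := by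
    induction hh using AddSubgroup.closure_induction with
    | mem d hd => exact fun x k hk => h1 k hk x d hd
    | zero => simp
    | add a b _ _ iha ihb =>
      intro x k hk
      have e1 := iha x k hk
      have e2 := ihb (x + a) k hk
      rw [show x + a + k = x + k + a by ring] at e2
      rw [← add_assoc, ← add_assoc]
      linear_combination e1 + e2
    | neg a _ ih =>
      intro x k hk
      have e1 := ih (x + -a) k hk
      rw [show x + -a + k = x + k + -a by ring, neg_add_cancel_right, neg_add_cancel_right] at e1
      linear_combination -e1
  simpa using h2 0 k hk

lemma eq_of_sub_and_add_mem {e c j x : R} (he : e ≠ 0) (he3 : 3 * e = 0) (hc : c ≠ 0)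
    (h₁ : x - e = j - e ∨ x - e = j + e ∨ x - e = j + c)
    (h₂ : x + e = j - e ∨ x + e = j + e ∨ x + e = j + c) : x = j := by
  rcases h₁ with h₁ | h₁ | h₁
  · exact sub_left_inj.1 h₁
  · rcases h₂ with h₂ | h₂ | h₂
    · exact absurd (by linear_combination h₂ - h₁ - he3) he
    · exact add_right_cancel h₂
    · exact absurd (by linear_combination h₁ - h₂ + he3) hc
  · rcases h₂ with h₂ | h₂ | h₂
    · exact absurd (by linear_combination h₂ - h₁ - he3) hc
    · exact add_right_cancel h₂
    · exact absurd (by linear_combination h₁ - h₂ + he3) he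

variable [DecidableEq R]

lemma exists_eq_insert_of_mem_diffs (hcard : S.card = 3) (hdiff : (S - S).card = 7)
    (hd : d ∈ diffs S) :
    ∃ s t, S = {s, s + d, t} ∧ IsHexagon (diffs S) d (s - t) (t - s - d) := by
  obtain ⟨hd0, hd⟩ := Finset.mem_erase.1 hd
  obtain ⟨p, hp, s, hs, rfl⟩ := Finset.mem_sub.1 hd
  have hps : p ≠ s := sub_ne_zero.1 hd0
  obtain ⟨t, ht⟩ : ∃ t, S = {s, p, t} := by
    have h1 : ((S.erase s).erase p).card = 1 := by
      rw [Finset.card_erase_of_mem (by simp [*]), Finset.card_erase_of_mem hs, hcard]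
    obtain ⟨t, ht⟩ := Finset.card_eq_one.1 h1
    refine ⟨t, ?_⟩
    rw [← ht, Finset.insert_erase (by simp [*]), Finset.insert_erase hs]
  have hS : S - S = [0, p - s, -(p - s), s - t, -(s - t), t - s - (p - s),
      -(t - s - (p - s))].toFinset := by
    ext u
    simp only [ht, Finset.mem_sub, Finset.mem_insert, Finset.mem_singleton, List.mem_toFinset,
      List.mem_cons, List.not_mem_nil, or_false, exists_eq_or_imp, exists_eq_left]
    grind
  have hnd : [0, p - s, -(p - s), s - t, -(s - t), t - s - (p - s),
      -(t - s - (p - s))].Nodup := by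
    rw [hS] at hdiff
    exact Multiset.toFinset_card_eq_card_iff_nodup.1 hdiff
  refine ⟨s, t, by simpa using ht, by ring, fun u => ?_, hnd⟩
  have hn := hnd
  simp only [List.nodup_cons, List.mem_cons, not_or] at hn
  simp only [diffs, hS, Finset.mem_erase, List.mem_toFinset, List.mem_cons, List.not_mem_nil,
    or_false]
  grind

/-- The common neighbours of `0` and `d` in the Cayley graph with connection set `D`. -/
def commonNbrs (D : Finset R) (d : R) : Finset R := D.filter (fun z => z - d ∈ D)

lemma IsHexagon.four_le_card_commonNbrs (h : IsHexagon D x y z) (h2 : 2 * x ∈ D)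
    (h3 : 3 * x ≠ 0) : 4 ≤ (commonNbrs D x).card := by
  have hn := h.ne
  have hs := h.sum_eq_zero
  have hm := h.mem_iff
  have key : 2 * x = y ∨ 2 * x = z := by
    rw [hm] at h2
    grind
  have hsub : ({-y, -z, -x, 2 * x} : Finset R) ⊆ commonNbrs D x := by
    intro t ht
    simp only [Finset.mem_insert, Finset.mem_singleton] at ht
    simp only [commonNbrs, Finset.mem_filter, hm]
    grind
  refine le_trans (le_of_eq ?_) (Finset.card_le_card hsub)
  rw [Finset.card_insert_of_notMem, Finset.card_insert_of_notMem, Finset.card_insert_of_notMem,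
    Finset.card_singleton]
  all_goals simp only [Finset.mem_insert, Finset.mem_singleton]
  all_goals grind

lemma IsHexagon.mem_commonNbrs (h : IsHexagon D x y z)
    (hD : ∀ d ∈ D, 2 * d ∈ D → 3 * d = 0) {t : R} :
    t ∈ commonNbrs D x ↔ t = -y ∨ t = -z ∨ (t = -x ∧ 3 * x = 0) := by
  have hn := h.ne
  have hs := h.sum_eq_zero
  have hm := h.mem_iff
  have h1 := hD x
  have h2 := hD y
  have h3 := hD z
  simp only [commonNbrs, Finset.mem_filter, hm] at *
  grind

lemma neg_mem_diffs : -d ∈ diffs S ↔ d ∈ diffs S := by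
  simp only [diffs, Finset.mem_erase, Finset.mem_sub, neg_ne_zero, ne_eq]
  refine and_congr_right fun _ => ⟨?_, ?_⟩ <;> rintro ⟨p, hp, q, hq, h⟩ <;>
    exact ⟨q, hq, p, hp, by linear_combination -h⟩

lemma exists_four_le_card_commonNbrs_iff (hcard : S.card = 3) (hdiff : (S - S).card = 7) :
    (∃ d ∈ diffs S, 4 ≤ (commonNbrs (diffs S) d).card) ↔
      ∃ d ∈ diffs S, 2 * d ∈ diffs S ∧ 3 * d ≠ 0 := by
  constructor
  · rintro ⟨d, hd, h4⟩
    by_contra! h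
    obtain ⟨s, t, -, hx⟩ := exists_eq_insert_of_mem_diffs hcard hdiff hd
    have hsub : commonNbrs (diffs S) d ⊆ {-(s - t), -(t - s - d), -d} := fun u hu => by
      have := (hx.mem_commonNbrs h).1 hu
      simp only [Finset.mem_insert, Finset.mem_singleton]
      tauto
    have := (Finset.card_le_card hsub).trans Finset.card_le_three
    omega
  · rintro ⟨d, hd, h2, h3⟩
    obtain ⟨s, t, -, hx⟩ := exists_eq_insert_of_mem_diffs hcard hdiff hd
    exact ⟨d, hd, hx.four_le_card_commonNbrs h2 h3⟩

lemma card_commonNbrs_eq_three_iff (hcard : S.card = 3) (hdiff : (S - S).card = 7)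
    (h : ∀ d ∈ diffs S, 2 * d ∈ diffs S → 3 * d = 0) (hd : d ∈ diffs S) :
    (commonNbrs (diffs S) d).card = 3 ↔ 3 * d = 0 := by
  obtain ⟨s, t, -, hx⟩ := exists_eq_insert_of_mem_diffs hcard hdiff hd
  have hn := hx.ne
  have hs := hx.sum_eq_zero
  constructor
  · intro hc
    by_contra h3
    have hsub : commonNbrs (diffs S) d ⊆ {-(s - t), -(t - s - d)} := fun u hu => by
      have := (hx.mem_commonNbrs h).1 hu
      simp only [Finset.mem_insert, Finset.mem_singleton]
      tauto
    have := (Finset.card_le_card hsub).trans Finset.card_le_two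
    omega
  · intro h3
    rw [Finset.card_eq_three]
    refine ⟨-(s - t), -(t - s - d), -d, by grind, by grind, by grind, ?_⟩
    ext u
    rw [hx.mem_commonNbrs h]
    simp [h3]

lemma add_eq_of_mem_commonNbrs (hcard : S.card = 3) (hdiff : (S - S).card = 7)
    (h : ∀ d ∈ diffs S, 2 * d ∈ diffs S → 3 * d = 0) (hd : d ∈ diffs S) (h3 : 3 * d ≠ 0)
    (hx : x ∈ commonNbrs (diffs S) d) (hy : y ∈ commonNbrs (diffs S) d) (hxy : x ≠ y) :
    x + y = d := by
  obtain ⟨s, t, -, hh⟩ := exists_eq_insert_of_mem_diffs hcard hdiff hd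
  rw [hh.mem_commonNbrs h] at hx hy
  grind

lemma exists_eq_of_three_mul_eq_zero (hcard : S.card = 3) (hdiff : (S - S).card = 7)
    (hd : d ∈ diffs S) (h3 : 3 * d = 0) :
    ∃ w c, S = {w - d, w + d, w + c} ∧ c ≠ 0 ∧ c ≠ d ∧ c ≠ -d := by
  obtain ⟨s, t, hS, hh⟩ := exists_eq_insert_of_mem_diffs hcard hdiff hd
  have hn := hh.ne
  refine ⟨s - d, t - (s - d), hS.trans ?_, by grind, by grind, by grind⟩
  have h1 : s - d - d = s + d := by linear_combination -h3
  rw [h1, sub_add_cancel, add_sub_cancel, Finset.insert_comm]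

lemma exists_eq_of_two_mul_mem (hcard : S.card = 3) (hdiff : (S - S).card = 7)
    (hd : d ∈ diffs S) (h2 : 2 * d ∈ diffs S) (h3 : 3 * d ≠ 0) :
    ∃ w c, S = {w, w + c, w + 3 * c} := by
  obtain ⟨s, t, hS, hh⟩ := exists_eq_insert_of_mem_diffs hcard hdiff hd
  have hn := hh.ne
  have hm := (hh.mem_iff _).1 h2
  have : t = s - 2 * d ∨ t = s + 3 * d := by grind
  rcases this with rfl | rfl
  · refine ⟨s + d, -d, ?_⟩
    rw [hS]
    ext u
    simp only [Finset.mem_insert, Finset.mem_singleton]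
    grind
  · exact ⟨s, d, hS⟩

section iso
variable {D₁ D₂ : Finset R} {σ : Equiv.Perm R}

lemma card_commonNbrs_map (hσ : ∀ x y, x - y ∈ D₁ ↔ σ x - σ y ∈ D₂) (x y : R) :
    (commonNbrs D₁ (x - y)).card = (commonNbrs D₂ (σ x - σ y)).card := by
  refine Finset.card_bij (fun z _ => σ (y + z) - σ y) ?_ ?_ ?_
  · intro z hz
    simp only [commonNbrs, Finset.mem_filter] at hz ⊢
    rw [sub_sub_sub_cancel_right, ← hσ, ← hσ]
    convert hz using 2 <;> ring_nf
  · intro a _ b _ h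
    simpa using h
  · intro z hz
    refine ⟨σ.symm (σ y + z) - y, ?_, by simp⟩
    simp only [commonNbrs, Finset.mem_filter] at hz ⊢
    rw [hσ, sub_sub_sub_cancel_right, hσ]
    simpa [add_sub_right_comm, add_sub_assoc, sub_sub_eq_add_sub, add_comm] using hz

lemma map_add_sub_map_eq (hcard₁ : S.card = 3) (hdiff₁ : (S - S).card = 7)
    (hσ : ∀ x y, x - y ∈ diffs S ↔ σ x - σ y ∈ D₂)
    (hD₂ : ∀ u ∈ D₂, ∀ x ∈ commonNbrs D₂ u, ∀ y ∈ commonNbrs D₂ u, x ≠ y → x + y = u)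
    {d e : R} (hd : d ∈ diffs S) (he : e ∈ diffs S) (x : R) :
    σ (x + d + e) - σ (x + d) = σ (x + e) - σ x := by
  have key : ∀ x d e f, d ∈ diffs S → e ∈ diffs S → f ∈ diffs S → e + f = d → e ≠ f →
      σ (x + e) - σ x + (σ (x + f) - σ x) = σ (x + d) - σ x := by
    intro x d e f hd he hf hs hne
    have hN : ∀ d ∈ diffs S, σ (x + d) - σ x ∈ D₂ := fun d hd => by
      rw [← hσ]; simpa using hd
    have hN' : ∀ e f, e ∈ diffs S → f ∈ diffs S → e + f = d →
        σ (x + e) - σ x ∈ commonNbrs D₂ (σ (x + d) - σ x) := by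
      intro e f he hf h
      refine Finset.mem_filter.2 ⟨hN e he, ?_⟩
      rw [sub_sub_sub_cancel_right, ← hσ, add_sub_add_left_eq_sub]
      rwa [show e - d = -f by rw [← h]; ring, neg_mem_diffs]
    refine hD₂ _ (hN d hd) _ (hN' e f he hf hs) _ (hN' f e hf he (by rw [add_comm, hs])) ?_
    simpa using hne
  have hneg : ∀ x, ∀ d ∈ diffs S, σ (x + -d) - σ x = -(σ (x + d) - σ x) := by
    intro x d hd
    obtain ⟨s, t, -, h⟩ := exists_eq_insert_of_mem_diffs hcard₁ hdiff₁ hd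
    generalize s - t = y at h
    generalize t - s - d = z at h
    have hs := h.sum_eq_zero
    have hn := h.ne
    have hm := h.mem_iff
    have h1 := key x d (-y) (-z) (by simp [hm]) (by simp [hm]) (by simp [hm]) (by grind) (by grind)
    have h2 := key x (-d) y z (by simp [hm]) (by simp [hm]) (by simp [hm]) (by grind) (by grind)
    have h3 := key x (-y) d z (by simp [hm]) (by simp [hm]) (by simp [hm]) (by grind) (by grind)
    have h4 := key x (-z) d y (by simp [hm]) (by simp [hm]) (by simp [hm]) (by grind) (by grind)
    linear_combination h1 - h2 + h3 + h4
  obtain ⟨s, t, -, h⟩ := exists_eq_insert_of_mem_diffs hcard₁ hdiff₁ hd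
  generalize s - t = y at h
  generalize t - s - d = z at h
  have hs := h.sum_eq_zero
  have hn := h.ne
  have hm := h.mem_iff
  have hpos : ∀ y z, y ∈ diffs S → z ∈ diffs S → d + y + z = 0 → d ≠ y →
      σ (x + d + y) - σ (x + d) = σ (x + y) - σ x := by
    intro y z hy hz hs hdy
    have := key x (-z) d y (neg_mem_diffs.2 hz) hd hy (by linear_combination hs) hdy
    rw [show x + d + y = x + -z by linear_combination hs]
    linear_combination -this
  have hy := hpos y z (by simp [hm]) (by simp [hm]) hs (by tauto)
  have hz := hpos z y (by simp [hm]) (by simp [hm]) (by linear_combination hs) (by tauto)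
  have hnn : ∀ e ∈ diffs S, σ (x + d + e) - σ (x + d) = σ (x + e) - σ x →
      σ (x + d + -e) - σ (x + d) = σ (x + -e) - σ x := fun e he h => by
    rw [hneg _ e he, hneg _ e he, h]
  have hdd : σ (x + d + -d) - σ (x + d) = σ (x + -d) - σ x := by
    rw [hneg x d hd]; simp
  rcases (hm e).1 he with rfl | rfl | rfl | rfl | rfl | rfl
  · simpa using hnn (-e) (neg_mem_diffs.2 he) hdd
  · exact hdd
  · exact hy
  · exact hnn _ (by simp [hm]) hy
  · exact hz
  · exact hnn _ (by simp [hm]) hz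

end iso

end

section ZModUnits
variable {v : ℕ} [NeZero v]

lemma ZMod.exists_units_mul_eq {x y : ZMod v} (h : addOrderOf x = addOrderOf y) :
    ∃ u : (ZMod v)ˣ, u * x = y := by
  have hv : v ≠ 0 := NeZero.ne v
  have key : ∀ x : ZMod v, ∃ u : (ZMod v)ˣ, x = u * ((v / addOrderOf x : ℕ) : ZMod v) := by
    intro x
    obtain ⟨d, hd, _, ⟨u, rfl⟩, hx⟩ := x.eq_unit_mul_divisor
    refine ⟨u, ?_⟩
    have hord : addOrderOf x = addOrderOf (d : ZMod v) := by
      rw [addOrderOf_eq_addOrderOf_iff]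
      intro n
      rw [hx, ← mul_smul_comm, Units.mul_right_eq_zero]
    rw [hord, ZMod.addOrderOf_coe _ hv, Nat.gcd_eq_right hd, Nat.div_div_self hd hv, ← hx]
  obtain ⟨a, ha⟩ := key x
  obtain ⟨b, hb⟩ := key y
  refine ⟨b * a⁻¹, ?_⟩
  rw [ha, hb, ← h, Units.val_mul, mul_assoc, Units.inv_mul_cancel_left]

lemma ZMod.eq_or_eq_neg_of_three_mul_eq_zero {x y : ZMod v} (hx : x ≠ 0) (hy : y ≠ 0)
    (hx3 : 3 * x = 0) (hy3 : 3 * y = 0) : y = x ∨ y = -x := by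
  have hle := IsAddCyclic.card_nsmul_eq_zero_le (α := ZMod v) (n := 3) (by norm_num)
  by_contra! hne
  have hxx : x ≠ -x := fun h => hx (by linear_combination hx3 - h)
  have hsub : ({0, x, -x, y} : Finset (ZMod v)) ⊆ Finset.univ.filter (fun a => 3 • a = 0) := by
    intro t ht
    simp only [Finset.mem_insert, Finset.mem_singleton] at ht
    simp only [Finset.mem_filter, Finset.mem_univ, true_and, nsmul_eq_mul, Nat.cast_ofNat]
    rcases ht with rfl | rfl | rfl | rfl
    · simp
    · exact hx3
    · simp [hx3]
    · exact hy3
  have h4 : ({0, x, -x, y} : Finset (ZMod v)).card = 4 := by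
    rw [Finset.card_insert_of_notMem, Finset.card_insert_of_notMem, Finset.card_insert_of_notMem,
      Finset.card_singleton]
    · simpa using fun h => hne.2 h.symm
    · simpa using ⟨hxx, hne.1.symm⟩
    · simpa using ⟨hx.symm, fun h => hx (by simpa using h), hy.symm⟩
  have := Finset.card_le_card hsub
  omega

lemma ZMod.exists_units_mul_eq_of_injective {H : AddSubgroup (ZMod v)} (f : H →+ ZMod v)
    (hf : Function.Injective f) : ∃ u : (ZMod v)ˣ, ∀ h : H, f h = u * h := by
  obtain ⟨g, hg⟩ := IsAddCyclic.exists_generator (α := H)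
  obtain ⟨u, hu⟩ := ZMod.exists_units_mul_eq (x := (g : ZMod v)) (y := f g)
    (by rw [addOrderOf_injective f hf, AddSubgroup.addOrderOf_coe])
  refine ⟨u, fun h => ?_⟩
  obtain ⟨n, rfl⟩ := AddSubgroup.mem_zmultiples_iff.1 (hg h)
  rw [map_zsmul, ← hu, AddSubgroup.coe_zsmul, mul_smul_comm]

end ZModUnits

section Configuration
variable {v : ℕ} {S S₁ S₂ : Finset (ZMod v)} {σ : Equiv.Perm (ZMod v)}

lemma multEquiv_of_eq_image (u : (ZMod v)ˣ) (t : ZMod v)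
    (h : S₂ = S₁.image (fun x => (u : ZMod v) * x + t)) : MultEquiv v S₁ S₂ := by
  refine ⟨u⁻¹, -(u⁻¹ * t), ?_⟩
  rw [h, Finset.image_image]
  refine Finset.image_id.symm.trans (Finset.image_congr fun x _ => ?_)
  simp [mul_add]

lemma MultEquiv.confIso (h : MultEquiv v S₁ S₂) : ConfIso v S₁ S₂ := by
  obtain ⟨a, b, rfl⟩ := h
  refine ⟨(Equiv.subRight b).trans (Units.mulLeft a⁻¹), ?_⟩
  have key : ∀ i : ZMod v, ((S₂.image (fun x => (a : ZMod v) * x + b)).image (· + i)).image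
      ((Equiv.subRight b).trans (Units.mulLeft a⁻¹)) = S₂.image (· + (a⁻¹ : (ZMod v)ˣ) * i) := by
    intro i
    rw [Finset.image_image, Finset.image_image]
    refine Finset.image_congr fun x _ => ?_
    have : (a : ZMod v) * x + b + i - b = a * x + i := by ring
    simp [this, mul_add]
  ext B
  constructor
  · rintro ⟨_, ⟨i, rfl⟩, rfl⟩
    exact ⟨_, key i⟩
  · rintro ⟨i, rfl⟩
    exact ⟨_, ⟨a * i, rfl⟩, by simpa using key (a * i)⟩

lemma sub_mem_diffs_iff {x y : ZMod v} :
    x - y ∈ diffs S ↔ x ≠ y ∧ ∃ B ∈ confLines v S, x ∈ B ∧ y ∈ B := by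
  rw [diffs, Finset.mem_erase, sub_ne_zero, Finset.mem_sub]
  refine and_congr_right fun _ => ⟨?_, ?_⟩
  · rintro ⟨p, hp, q, hq, h⟩
    refine ⟨_, ⟨y - q, rfl⟩, Finset.mem_image.2 ⟨p, hp, ?_⟩, Finset.mem_image.2 ⟨q, hq, ?_⟩⟩
    · linear_combination h
    · ring
  · rintro ⟨_, ⟨i, rfl⟩, hx, hy⟩
    obtain ⟨p, hp, rfl⟩ := Finset.mem_image.1 hx
    obtain ⟨q, hq, rfl⟩ := Finset.mem_image.1 hy
    exact ⟨p, hp, q, hq, by ring⟩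

lemma sub_mem_diffs_iff_map
    (h : (fun B : Finset (ZMod v) => B.image σ) '' confLines v S₁ = confLines v S₂)
    (x y : ZMod v) : x - y ∈ diffs S₁ ↔ σ x - σ y ∈ diffs S₂ := by
  rw [sub_mem_diffs_iff, sub_mem_diffs_iff, ← h, σ.injective.ne_iff, Set.exists_mem_image]
  simp

lemma exists_four_le_card_map (hσ : ∀ x y, x - y ∈ diffs S₁ ↔ σ x - σ y ∈ diffs S₂) :
    (∃ d ∈ diffs S₁, 4 ≤ (commonNbrs (diffs S₁) d).card) ↔
      ∃ d ∈ diffs S₂, 4 ≤ (commonNbrs (diffs S₂) d).card := by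
  constructor
  · rintro ⟨d, hd, h⟩
    rw [← sub_zero d] at hd h
    exact ⟨_, (hσ _ _).1 hd, by rwa [card_commonNbrs_map hσ] at h⟩
  · rintro ⟨d, hd, h⟩
    have h1 : d = σ (σ.symm d) - σ (σ.symm 0) := by simp
    rw [h1] at hd h
    exact ⟨_, (hσ _ _).2 hd, by rwa [card_commonNbrs_map hσ]⟩

lemma map_sub_mem_closure {D₁ D₂ : Set (ZMod v)}
    (hσ : ∀ x y, x - y ∈ D₁ → σ x - σ y ∈ D₂) {h : ZMod v}
    (hh : h ∈ AddSubgroup.closure D₁) (x : ZMod v) :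
    σ (x + h) - σ x ∈ AddSubgroup.closure D₂ := by
  induction hh using AddSubgroup.closure_induction generalizing x with
  | mem d hd => exact AddSubgroup.subset_closure (hσ _ _ (by simpa using hd))
  | zero => simp
  | add a b _ _ iha ihb =>
    have := add_mem (iha x) (ihb (x + a))
    rwa [add_comm, sub_add_sub_cancel, add_assoc] at this
  | neg a _ ih =>
    have := neg_mem (ih (x + -a))
    rwa [neg_add_cancel_right, neg_sub] at this

lemma card_closure_le [NeZero v] {D₁ D₂ : Set (ZMod v)}
    (hσ : ∀ x y, x - y ∈ D₁ → σ x - σ y ∈ D₂) :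
    Nat.card (AddSubgroup.closure D₁) ≤ Nat.card (AddSubgroup.closure D₂) := by
  refine Nat.card_le_card_of_injective
    (fun h => ⟨σ (0 + h) - σ 0, map_sub_mem_closure hσ h.2 0⟩) fun a b h => ?_
  simpa using h

lemma closure_diffs_eq_zmultiples {w c : ZMod v} (hc : c ≠ 0) (hS : S = {w, w + c, w + 3 * c}) :
    AddSubgroup.closure (diffs S : Set (ZMod v)) = AddSubgroup.zmultiples c := by
  apply le_antisymm
  · rw [AddSubgroup.closure_le]
    have h0 : ∀ s ∈ S, s - w ∈ AddSubgroup.zmultiples c := by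
      simp only [hS, Finset.mem_insert, Finset.mem_singleton, forall_eq_or_imp, forall_eq,
        sub_self, add_sub_cancel_left]
      exact ⟨zero_mem _, AddSubgroup.mem_zmultiples c,
        AddSubgroup.mem_zmultiples_iff.2 ⟨3, by simp⟩⟩
    intro d hd
    obtain ⟨-, hd⟩ := Finset.mem_erase.1 hd
    obtain ⟨p, hp, q, hq, rfl⟩ := Finset.mem_sub.1 hd
    simpa using sub_mem (h0 p hp) (h0 q hq)
  · rw [AddSubgroup.zmultiples_le]
    refine AddSubgroup.subset_closure (Finset.mem_coe.2 (Finset.mem_erase.2 ⟨hc, ?_⟩))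
    exact Finset.mem_sub.2 ⟨w + c, by simp [hS], w, by simp [hS], by ring⟩

/-- The case in which both base lines are affinely equivalent to multiples of `{0, 1, 3}`. -/
lemma multEquiv_of_two_mul_mem [NeZero v] (hcard₁ : S₁.card = 3) (hdiff₁ : (S₁ - S₁).card = 7)
    (hcard₂ : S₂.card = 3) (hdiff₂ : (S₂ - S₂).card = 7)
    (hσ : ∀ x y, x - y ∈ diffs S₁ ↔ σ x - σ y ∈ diffs S₂)
    (h₁ : ∃ d ∈ diffs S₁, 2 * d ∈ diffs S₁ ∧ 3 * d ≠ 0)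
    (h₂ : ∃ d ∈ diffs S₂, 2 * d ∈ diffs S₂ ∧ 3 * d ≠ 0) : MultEquiv v S₁ S₂ := by
  obtain ⟨d₁, hd₁, h2₁, h3₁⟩ := h₁
  obtain ⟨d₂, hd₂, h2₂, h3₂⟩ := h₂
  obtain ⟨w, c, hS₁⟩ := exists_eq_of_two_mul_mem hcard₁ hdiff₁ hd₁ h2₁ h3₁
  obtain ⟨w', c', hS₂⟩ := exists_eq_of_two_mul_mem hcard₂ hdiff₂ hd₂ h2₂ h3₂
  have hc : c ≠ 0 := by rintro rfl; simp [hS₁] at hcard₁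
  have hc' : c' ≠ 0 := by rintro rfl; simp [hS₂] at hcard₂
  have e₁ := closure_diffs_eq_zmultiples hc hS₁
  have e₂ := closure_diffs_eq_zmultiples hc' hS₂
  have hord : addOrderOf c = addOrderOf c' := by
    rw [← Nat.card_zmultiples, ← Nat.card_zmultiples, ← e₁, ← e₂]
    refine le_antisymm (card_closure_le (σ := σ) fun x y => (hσ x y).1)
      (card_closure_le (σ := σ.symm) fun x y h => (hσ _ _).2 (by simpa using h))
  obtain ⟨u, rfl⟩ := ZMod.exists_units_mul_eq hord
  refine multEquiv_of_eq_image u (w' - u * w) ?_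
  rw [hS₁, hS₂]
  simp only [Finset.image_insert, Finset.image_singleton]
  congr 1
  · ring
  · congr 1
    · ring
    · congr 1
      ring

/-- The case in which some difference of each base line has order three. -/
lemma multEquiv_of_three_mul_eq_zero [NeZero v]
    (hcard₁ : S₁.card = 3) (hdiff₁ : (S₁ - S₁).card = 7)
    (hcard₂ : S₂.card = 3) (hdiff₂ : (S₂ - S₂).card = 7)
    (h : (fun B : Finset (ZMod v) => B.image σ) '' confLines v S₁ = confLines v S₂)
    (h₁ : ∀ d ∈ diffs S₁, 2 * d ∈ diffs S₁ → 3 * d = 0)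
    (h₂ : ∀ d ∈ diffs S₂, 2 * d ∈ diffs S₂ → 3 * d = 0)
    {d : ZMod v} (hd : d ∈ diffs S₁) (h3 : 3 * d = 0) : MultEquiv v S₁ S₂ := by
  have hσ := sub_mem_diffs_iff_map h
  have h3iff : ∀ x y, x - y ∈ diffs S₁ → (3 * (x - y) = 0 ↔ 3 * (σ x - σ y) = 0) := by
    intro x y hxy
    rw [← card_commonNbrs_eq_three_iff hcard₁ hdiff₁ h₁ hxy, card_commonNbrs_map hσ,
      card_commonNbrs_eq_three_iff hcard₂ hdiff₂ h₂ ((hσ _ _).1 hxy)]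
  have hd0 : d ≠ 0 := (Finset.mem_erase.1 hd).1
  obtain ⟨e, he⟩ : ∃ e, e = σ d - σ 0 := ⟨_, rfl⟩
  have he2 : e ∈ diffs S₂ := by rw [he, ← hσ]; simpa using hd
  have he3 : 3 * e = 0 := by rw [he, ← h3iff _ _ (by simpa using hd)]; simpa using h3
  have he0 : e ≠ 0 := (Finset.mem_erase.1 he2).1
  obtain ⟨w, c, hS₁, -, hcd, hcd'⟩ := exists_eq_of_three_mul_eq_zero hcard₁ hdiff₁ hd h3
  obtain ⟨w', c', hS₂, hc', -, -⟩ := exists_eq_of_three_mul_eq_zero hcard₂ hdiff₂ he2 he3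
  have hstep : ∀ x, (σ (x + d) = σ x + e ∧ σ (x - d) = σ x - e) ∨
      (σ (x + d) = σ x - e ∧ σ (x - d) = σ x + e) := by
    intro x
    have key : ∀ d ∈ diffs S₁, 3 * d = 0 → σ (x + d) = σ x + e ∨ σ (x + d) = σ x - e := by
      intro d hd h3
      have hm : x + d - x ∈ diffs S₁ := by simpa using hd
      have hm2 := (hσ _ _).1 hm
      have := ZMod.eq_or_eq_neg_of_three_mul_eq_zero he0 (Finset.mem_erase.1 hm2).1 he3
        ((h3iff _ _ hm).1 (by simpa using h3))
      grind
    have k1 := key d hd h3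
    have k2 := key (-d) (neg_mem_diffs.2 hd) (by linear_combination -h3)
    have hne : σ (x + d) ≠ σ (x + -d) := fun h => by
      have := σ.injective h
      exact hd0 (by linear_combination h3 - this)
    rw [sub_eq_add_neg x d]
    grind
  have hshift : ∀ x, σ (x + c) = σ x + c' := by
    intro x
    have hline : (S₁.image (· + (x - w))).image σ ∈ confLines v S₂ := by
      rw [← h]; exact ⟨_, ⟨_, rfl⟩, rfl⟩
    obtain ⟨i, hi⟩ := hline
    have hmem : ∀ t, t = x - d ∨ t = x + d ∨ t = x + c →
        σ t = (w' + i) - e ∨ σ t = (w' + i) + e ∨ σ t = (w' + i) + c' := by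
      intro t ht
      have : σ t ∈ (S₁.image (· + (x - w))).image σ := by
        refine Finset.mem_image_of_mem _ (Finset.mem_image.2 ⟨t - (x - w), ?_, by ring⟩)
        simp only [hS₁, Finset.mem_insert, Finset.mem_singleton]
        rcases ht with rfl | rfl | rfl
        · exact Or.inl (by ring)
        · exact Or.inr (Or.inl (by ring))
        · exact Or.inr (Or.inr (by ring))
      rw [hi, hS₂] at this
      simpa [eq_comm, add_right_comm, sub_add_eq_add_sub] using this
    have m1 := hmem (x - d) (by simp)
    have m2 := hmem (x + d) (by simp)
    have m3 := hmem (x + c) (by simp)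
    have n1 : σ (x + c) ≠ σ (x + d) := fun h => hcd (by simpa using h)
    have n2 : σ (x + c) ≠ σ (x - d) := fun h => hcd' (by
      have := σ.injective h; linear_combination this)
    rcases hstep x with ⟨ha, hb⟩ | ⟨ha, hb⟩
    · rw [ha] at m2 n1
      rw [hb] at m1 n2
      have hx := eq_of_sub_and_add_mem he0 he3 hc' m1 m2
      rw [← hx] at m3
      tauto
    · rw [ha] at m2 n1
      rw [hb] at m1 n2
      have hx := eq_of_sub_and_add_mem he0 he3 hc' m2 m1
      rw [← hx] at m3
      tauto
  have hnat : ∀ n : ℕ, σ (n • c) = σ 0 + n • c' := by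
    intro n
    induction n with
    | zero => simp
    | succ n ih => rw [succ_nsmul, hshift, ih, succ_nsmul, add_assoc]
  have hord : addOrderOf c = addOrderOf c' := by
    rw [addOrderOf_eq_addOrderOf_iff]
    intro n
    have := hnat n
    constructor
    · intro h0
      simpa [h0] using this
    · intro h0
      rw [h0, add_zero] at this
      exact σ.injective this
  obtain ⟨u, rfl⟩ := ZMod.exists_units_mul_eq hord
  refine multEquiv_of_eq_image u (w' - u * w) ?_
  have hud := ZMod.eq_or_eq_neg_of_three_mul_eq_zero he0 (y := (u : ZMod v) * d)
    (by rwa [Ne, Units.mul_right_eq_zero]) he3 (by linear_combination (u : ZMod v) * h3)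
  rw [hS₁, hS₂]
  simp only [Finset.image_insert, Finset.image_singleton]
  have hwc : (u : ZMod v) * (w + c) + (w' - u * w) = w' + u * c := by ring
  have hwa : (u : ZMod v) * (w + d) + (w' - u * w) = w' + u * d := by ring
  have hws : (u : ZMod v) * (w - d) + (w' - u * w) = w' - u * d := by ring
  rw [hwc, hwa, hws]
  rcases hud with hud | hud
  · rw [hud]
  · rw [hud, sub_neg_eq_add, ← sub_eq_add_neg, Finset.insert_comm]

/-- The case in which the collinearity graphs have no sporadic triangles. -/
lemma multEquiv_of_three_mul_ne_zero [NeZero v]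
    (hcard₁ : S₁.card = 3) (hdiff₁ : (S₁ - S₁).card = 7)
    (hcard₂ : S₂.card = 3) (hdiff₂ : (S₂ - S₂).card = 7)
    (h : (fun B : Finset (ZMod v) => B.image σ) '' confLines v S₁ = confLines v S₂)
    (h₂ : ∀ d ∈ diffs S₂, 2 * d ∈ diffs S₂ → 3 * d = 0)
    (h3 : ∀ d ∈ diffs S₂, 3 * d ≠ 0) : MultEquiv v S₁ S₂ := by
  have hσ := sub_mem_diffs_iff_map h
  have hadd := fun {h k} hh hk => map_add_of_mem_closure (D := (diffs S₁ : Set (ZMod v))) (f := σ)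
    (h := h) (k := k) (fun x d hd e he => map_add_sub_map_eq hcard₁ hdiff₁ hσ
      (fun u hu x hx y hy hxy => add_eq_of_mem_commonNbrs hcard₂ hdiff₂ h₂ hu (h3 u hu) hx hy hxy)
      hd he x) hh hk
  obtain ⟨u, hu⟩ := ZMod.exists_units_mul_eq_of_injective
    (AddMonoidHom.mk' (fun g : AddSubgroup.closure (diffs S₁ : Set (ZMod v)) => σ g - σ 0)
      fun a b => by
        have := hadd b.2 a.2
        rw [AddSubgroup.coe_add]
        linear_combination this) fun a b hab => by simpa using hab
  obtain ⟨s, hs⟩ : S₁.Nonempty := Finset.card_pos.1 (by omega)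
  have himg : (S₁.image (· + -s)).image σ ∈ confLines v S₂ := by
    rw [← h]; exact ⟨_, ⟨_, rfl⟩, rfl⟩
  obtain ⟨i, hi⟩ := himg
  have himg2 : (S₁.image (· + -s)).image σ = S₁.image (fun x => u * (x - s) + σ 0) := by
    rw [Finset.image_image]
    refine Finset.image_congr fun x hx => ?_
    have hmem : x - s ∈ AddSubgroup.closure (diffs S₁ : Set (ZMod v)) := by
      by_cases hxs : x - s = 0
      · rw [hxs]; exact zero_mem _
      · exact AddSubgroup.subset_closure
          (Finset.mem_erase.2 ⟨hxs, Finset.sub_mem_sub hx hs⟩)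
    have := hu ⟨_, hmem⟩
    simp only [AddMonoidHom.mk'_apply] at this
    simp only [Function.comp_apply, ← sub_eq_add_neg]
    linear_combination this
  refine multEquiv_of_eq_image u (σ 0 - u * s - i) ?_
  have : S₂ = (S₂.image (· + i)).image (· + -i) := by
    rw [Finset.image_image]
    exact Finset.image_id.symm.trans (Finset.image_congr fun x _ => by simp)
  rw [this, ← hi, himg2, Finset.image_image]
  refine Finset.image_congr fun x _ => ?_
  simp only [Function.comp_apply]
  ring

end Configuration

/-- two cyclic configurations of type (v₃) are isomorphic iff they are
multiplier equivalent. -/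
theorem confIso_iff_multEquiv_type_v3
    (v : ℕ) (hv : 7 ≤ v)
    (S₁ S₂ : Finset (ZMod v))
    (hcard₁ : S₁.card = 3) (hdiff₁ : (S₁ - S₁).card = 7)
    (hcard₂ : S₂.card = 3) (hdiff₂ : (S₂ - S₂).card = 7) :
    ConfIso v S₁ S₂ ↔ MultEquiv v S₁ S₂ := by
  refine ⟨?_, MultEquiv.confIso⟩
  rintro ⟨σ, h⟩
  have : NeZero v := ⟨by omega⟩
  have hσ := sub_mem_diffs_iff_map h
  have hiff := exists_four_le_card_map hσ
  rw [exists_four_le_card_commonNbrs_iff hcard₁ hdiff₁,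
    exists_four_le_card_commonNbrs_iff hcard₂ hdiff₂] at hiff
  by_cases h₁ : ∃ d ∈ diffs S₁, 2 * d ∈ diffs S₁ ∧ 3 * d ≠ 0
  · exact multEquiv_of_two_mul_mem hcard₁ hdiff₁ hcard₂ hdiff₂ hσ h₁ (hiff.1 h₁)
  have h₂ := mt hiff.2 h₁
  push Not at h₁ h₂
  by_cases h3 : ∀ d ∈ diffs S₂, 3 * d ≠ 0
  · exact multEquiv_of_three_mul_ne_zero hcard₁ hdiff₁ hcard₂ hdiff₂ h h₂ h3
  push Not at h3
  obtain ⟨e, he, he3⟩ := h3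
  have he1 : e = σ (σ.symm e) - σ (σ.symm 0) := by simp
  rw [he1] at he he3
  have hd := (hσ _ _).2 he
  refine multEquiv_of_three_mul_eq_zero hcard₁ hdiff₁ hcard₂ hdiff₂ h h₁ h₂ hd ?_
  rwa [← card_commonNbrs_eq_three_iff hcard₁ hdiff₁ h₁ hd, card_commonNbrs_map hσ,
    card_commonNbrs_eq_three_iff hcard₂ hdiff₂ h₂ he]
end

section
/- Let v ≥ 13 and for r = 1, 2 let S_r ⊆ Z_v satisfy |S_r| = 4 and |S_r − S_r| = 13 (so that S_r is a base line of a cyclic configuration of type (v_4)). Then Conf(Z_v, S₁) and Conf(Z_v, S₂) are isomorphic if and only if they are multiplier equivalent, i.e., if and only if there exist a unit a ∈ Z_v* and b ∈ Z_v such that S₁ = aS₂ + b. -/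
open scoped Pointwise

namespace CyclicConf

/-- Coefficients of the differences `F 1 - F 0`, `F 2 - F 0`, `F 3 - F 0`. -/
abbrev Vec := ℤ × ℤ × ℤ

/-- Three vectors, thought of as the rows of a matrix in echelon form. -/
abbrev Rows := Vec × Vec × Vec

/-- The vector of `F k - F 0`. -/
def unitVec : ℕ → Vec
  | 0 => (0, 0, 0)
  | 1 => (1, 0, 0)
  | 2 => (0, 1, 0)
  | _ => (0, 0, 1)

/-- `w - q • r`. -/
def subMul (w : Vec) (q : ℤ) (r : Vec) : Vec :=
  (w.1 - q * r.1, w.2.1 - q * r.2.1, w.2.2 - q * r.2.2)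

/-- Reduce `w` by the rows; `true` certifies that `w` is in their integer span. -/
def Rows.mem (B : Rows) (w : Vec) : Bool :=
  let w₁ := subMul w (w.1 / B.1.1) B.1
  let w₂ := subMul w₁ (w₁.2.1 / B.2.1.2.1) B.2.1
  let w₃ := subMul w₂ (w₂.2.2 / B.2.2.2.2) B.2.2
  w₃.1 == 0 && w₃.2.1 == 0 && w₃.2.2 == 0

/-- Euclidean algorithm on the coordinate `c` of two vectors. -/
def euclid (c : Vec → ℤ) : ℕ → Vec → Vec → Vec × Vec
  | 0, r, w => (r, w)
  | fuel + 1, r, w =>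
    if c w == 0 then (r, w) else euclid c fuel w (subMul r (c r / c w) w)

/-- Add a vector to the span of the rows. -/
def Rows.insert (B : Rows) (w : Vec) : Rows :=
  let x₁ := euclid (fun w => w.1) 8 B.1 w
  let x₂ := euclid (fun w => w.2.1) 8 B.2.1 x₁.2
  let x₃ := euclid (fun w => w.2.2) 8 B.2.2 x₂.2
  (x₁.1, x₂.1, x₃.1)

/-- The `k`-th base-four digit; functions `Fin 4 → Fin 4` are encoded by four digits. -/
def dig (p k : ℕ) : ℕ := (p >>> (2 * k)) % 4

/-- Codes of the permutations of four letters. -/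
def permCodes : List ℕ :=
  [228, 180, 216, 120, 156, 108, 225, 177, 201, 57, 141, 45,
   210, 114, 198, 54, 78, 30, 147, 99, 135, 39, 75, 27]

/-- The action of an index map on vectors. -/
def permVec (p : ℕ) (w : Vec) : Vec :=
  subMul (subMul (subMul (subMul (0, 0, 0) (w.1 + w.2.1 + w.2.2) (unitVec (dig p 0)))
    (-w.1) (unitVec (dig p 1))) (-w.2.1) (unitVec (dig p 2))) (-w.2.2) (unitVec (dig p 3))

/-- A type of four-element Sidon sets: a sample `(0, s1, s2, s3)` modulo `n` satisfying the same
relations of length six, the rows spanning these relations (if `full` is not set), the table of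
the numbers of paths of length three, and certificates for the successors of the pattern. -/
structure Pattern where
  n : ℕ
  s1 : ℕ
  s2 : ℕ
  s3 : ℕ
  full : Bool
  rows : Rows
  table : ℕ
  children : ℕ

/-- The pattern of `(0, 1, s2, s3)` in a cyclic group of order `n`. -/
def Pattern.mkFull (n s2 s3 table : ℕ) : Pattern :=
  ⟨n, 1, s2, s3, true, ((0, 0, 0), (0, 0, 0), (0, 0, 0)), table, 0⟩

/-- The sample of a pattern. -/
def Pattern.s (P : Pattern) : ℕ → ℕ
  | 0 => 0
  | 1 => P.s1
  | 2 => P.s2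
  | _ => P.s3

/-- Whether a vector is a relation of the sample modulo `n`. -/
def Pattern.sat (P : Pattern) (n : ℕ) (w : Vec) : Bool :=
  (w.1 * P.s1 + w.2.1 * P.s2 + w.2.2 * P.s3) % n == 0

/-- Whether a closed walk of length six exists in the sample. -/
def Pattern.rel (P : Pattern) (a b c d e f : ℕ) : Bool :=
  (P.s a + P.s c + P.s e) % P.n == (P.s b + P.s d + P.s f) % P.n

/-- The relations defining a pattern. -/
def Pattern.gens (P : Pattern) : List Vec :=
  bif P.full then [(P.n, 0, 0), (P.s2, -1, 0), (P.s3, 0, -1)]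
  else [P.rows.1, P.rows.2.1, P.rows.2.2]

/-- An entry of the table of path numbers. -/
def Pattern.entry (P : Pattern) (c a b : ℕ) : ℕ :=
  (P.table >>> (4 * (16 * c + 4 * a + b))) % 16

/-- All patterns. -/
def patterns : List Pattern := [
  ⟨30, 1, 5, 19, false, ((0, 0, 0), (0, 0, 0), (0, 0, 0)),
    111346476208460234870614421293990117505124740723097019043954235879260160,
    9515090314154468569929089105531827740138410556322264482759547825380720570025814860192397296704297983041103569823334111257732522669157135733935900225549⟩,
  ⟨28, 3, 12, 1, false, ((1, 0, -3), (0, 0, 0), (0, 0, 0)),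
    111348161256548949201889276799775843192151343183868751264099246517846016,
    14369934554606656015297021749243164571423822668332200139523580086972167920047513995861727187340364379771530740301296336869904550950497592305362944⟩,
  ⟨30, 1, 5, 12, false, ((1, 1, -3), (0, 0, 0), (0, 0, 0)),
    332205729350513688943065143251090509732475644746966910385573587316703232,
    30574166789482597825376568130050149525489129374407982202851886408113374593422013254072158822301349042499479944976769147491252151757921296828189650944⟩,
  ⟨24, 4, 1, 15, false, ((1, 2, -2), (0, 0, 0), (0, 0, 0)),
    332257964607135465698253009584527949257219640631015594252776023116546048,
    46252838682954303236328211850756205527942855352983023044967675291834384127570591766707311562305160599673755157038093437043686339935467595130981397508637⟩,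
  ⟨30, 3, 29, 19, false, ((0, 0, 0), (0, 3, -3), (0, 0, 0)),
    221774417757109279989499168944644258477894918682770141826380578397683712,
    324270606378208793425882893113590023162225719981531144516997129228168261577645810090059578937246231746916718563232335843824808446442947953370808150509⟩,
  ⟨28, 9, 1, 3, false, ((1, 0, -3), (0, 3, -1), (0, 0, 0)),
    111375121203216124361612597669258821128240935226531477535428966871007232,
    5079354301062452866029199262585026541192457359310010524852003194996399834950350397427493110665412465178682094641727674917981872579411968⟩,
  ⟨32, 4, 1, 12, false, ((1, 0, 5), (0, 0, 0), (0, 0, 8)),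
    111348161667925088532190787338518138914565719166110550024792512596672512,
    39275151219716069184518433347348766056075000671490360148581855326654724132304640812602235058649770272008621590299777741260708160766724772932696064⟩,
  ⟨24, 3, 10, 1, false, ((1, 0, -3), (0, 3, -6), (0, 0, 0)),
    111348161256548949201889288217844497125763498775565873253302029208584192,
    41387556955909065440099973453970838867868869183349319066361295835719555346480975083013378935561550073822827165001233332281687437503707656929411072⟩,
  ⟨25, 3, 18, 1, false, ((1, 0, -3), (0, 3, -4), (0, 0, 0)),
    111806480349890559118255935182854410600575210190347761182034484623638528,
    4479660526790929921766814430207747650479873954277486435867888000380509727416321902795354921517563351253832085147888968524485756800991232⟩,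
  ⟨26, 3, 18, 1, false, ((1, 0, -3), (0, 3, -2), (0, 0, 0)),
    221803062751865169480497345319825849815079352939557976418352772432330752,
    1015147103881707122491033243488848312378915698221757185143522653502418909587730233669052924735438921913356869156671738252695175168⟩,
  ⟨22, 10, 19, 18, false, ((1, 0, -3), (0, 2, -7), (0, 0, 0)),
    112210879549998227918794444795704663430820045227841304283918943941361664,
    36934923487352902580635946030456874969392193702331925340074996435661970062586045412612764632397619500184912305154650553598171074097826135805130752⟩,
  ⟨26, 24, 23, 8, false, ((1, 0, -3), (0, 2, -9), (0, 0, 0)),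
    111348161256548949201889282531067359214524025859749098941436326330826752,
    28740619347244151493963224302020485609412410269832017550520393898380612388585910763119985207550073070872897490188486364046627492819281846844835840⟩,
  ⟨25, 3, 8, 1, false, ((1, 0, -3), (0, 1, -8), (0, 0, 0)),
    111348266980216757089377576622698901048040333970801412129531791600058368,
    36935209287429500010619061857907173876752565607387293199763142664238974631273638679848813936808407888737410453334526741326300905272561598032082944⟩,
  ⟨25, 3, 10, 1, false, ((1, 0, -3), (0, 3, -5), (0, 0, 0)),
    222207461951872429077417356255034802813416192646051765630812903289454592,
    4260674935554303908174700763919091102902895658301770349168790965668987345491221502163774946734753327484975175772076541339150251299176448⟩,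
  ⟨30, 3, 13, 1, false, ((1, 0, -3), (0, 3, -9), (0, 0, 0)),
    111348161256548949201889282508766614015992135067612857291481288752037888,
    30485861415917557052353195742506777355919809646512996958265245275492272770876062607930412442223169131468105728825940571559954796176871541564243968⟩,
  ⟨26, 3, 17, 1, false, ((1, 0, -3), (0, 2, -8), (0, 0, 0)),
    111348266568840617759076071770646630950934859080167772894170709529526272,
    33423527976939020322759255211950458538863878039218291940727169455796544424765663149925552870662368437881431841828779436571977693041205346128525312⟩,
  ⟨23, 3, 18, 1, false, ((1, 0, -3), (0, 1, 5), (0, 0, 0)),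
    111375122025968380034782505758247202907893475522282386248635917130727424,
    17064917269145266981391253777670315994788136057414607827716877513810918667977823889585869771762230487919679902416274092479659720115117774977024⟩,
  ⟨22, 3, 10, 1, false, ((1, 0, -3), (0, 2, 2), (0, 0, 0)),
    111402081561259415864204316088987885121568691582703313759272371405062144,
    1001166814823259668158157287039758657058368763602432727690515364176510040674599210748531611098711796942645882092230211473275617280⟩,
  ⟨27, 9, 26, 3, false, ((1, 0, 6), (0, 0, 0), (0, 0, 9)),
    111348161256548949201889276799775843192151343183869046412004425870737408,
    31656517118625085299023893688735132391256064058115921197397452746939582470853039237423890115712756874928007535919932247864031724597964633161078784⟩,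
  ⟨30, 3, 10, 1, false, ((1, 0, -3), (0, 3, 0), (0, 0, 0)),
    111348161256548949201889276799862955478083103430515375163601783474946048,
    843443955287525200538444934225290454700982418015267450908270652406767748458191163156209731774628339198547857020296270123076943872⟩,
  ⟨24, 4, 23, 17, false, ((1, 1, -3), (0, 4, -4), (0, 0, 0)),
    332664048443855298859431801634169077140899511753445920303508825422495744,
    7553321178149936288170394565370629271827651250580648350019022153871660375055778642136431963021034532444974382988833079021582663732252639232⟩,
  ⟨30, 1, 11, 4, false, ((1, 1, -3), (0, 6, -9), (0, 0, 0)),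
    332205729350513688943065148960081280556316436630711016412955629550895104,
    56757924977934478402478509064547368854296965691423388794185422559753136257836051808303072141097649135790582665296588951934054358454076640193866104832⟩,
  ⟨24, 2, 18, 19, false, ((1, 2, -2), (0, 9, -6), (0, 0, 0)),
    332257964607135465698253015293518720081060432514759700280158065350737920,
    343268299847300724937422319857289395897514319711501696558351838805201114587563623909992653306899695951020704424477388831643930061635162811968696353826⟩,
  ⟨20, 4, 9, 1, false, ((1, 2, -2), (0, 5, -5), (0, 0, 0)),
    332689323754010743286281026959082552654324201951467640359950357257977856,
    129260601003217900981950205851084817164057778567759105701430709245484242296452093234367494176313706444109973626142874325515771601437641545694795182603553⟩,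
  ⟨24, 8, 23, 3, false, ((1, 2, -2), (0, 6, -6), (0, 0, 0)),
    332257964607135465698253009584527949257219640631015889400681202469437440,
    364948063087737747473621909370707464881571527507987096324926014300692031399244580630556024604660396452470807193832125122294800216711839019216419325058⟩,
  ⟨24, 3, 1, 17, false, ((1, 0, -3), (0, 3, -3), (0, 0, 0)),
    221776102805197994320774030159594979560624645098141513907848866449915904,
    3517786598631492529865331428962066098734986303198702583643405975478630677441814937800507848267748708991306093384082903941173582334263296⟩,
  ⟨22, 6, 21, 2, false, ((1, 0, -3), (0, 2, 1), (0, 0, 0)),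
    332259649656831118073786855367336545897427329887302135758528365413335040,
    178498022822757561819011862850018246491984580109804856700487984294469430845416785814465261422251654991220739168076728107008⟩,
  ⟨20, 3, 16, 1, false, ((1, 0, -3), (0, 1, 4), (0, 0, 0)),
    221806433569658167668233650966611478669617845603444773071148995594878976,
    657908893532196427494313769494603110945003712173409624995523733734149844745679404744716342081536⟩,
  ⟨28, 12, 1, 4, false, ((1, 0, 4), (0, 0, 0), (0, 0, 7)),
    111349846664692219074944140919182450355330893886927396418179336692236288,
    12265781428624999993602924906490189425978835567487505146149029021670309739126175087122377481081183330587318574901492370150816880879694182873088⟩,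
  ⟨19, 3, 12, 1, false, ((1, 0, -3), (0, 2, -5), (0, 0, 0)),
    333066973299197577599192676443053589138151863768824846412249328691249152,
    13349460709013650839333471129821782879768270258710352071984587739479718559522390310248899317779262027953585403607230873722461566602090691690496⟩,
  ⟨21, 20, 3, 13, false, ((1, 2, -2), (0, 6, -3), (0, 0, 0)),
    332259860229992437771872756491735334460074781554314255286931293284139008,
    362422519702669511923639344829297746922817691249907026656312396852944817567192701730798847780705418078389721632296246760779207084699730844849992105984⟩,
  .mkFull 26 3 9 111375121203216124361612597691559566326772826018668014333289183802687488,
  .mkFull 25 3 9 111376806174171812568455919971331111659308076436396417274751033704316928,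
  .mkFull 23 3 8 111806480349890559118255935205155155799107100982484297979894701555318784,
  .mkFull 22 3 9 221804747697109825991763710224980985103449944427457583146338822427639808,
  .mkFull 27 3 9 111373436180838418738481586594445234117204825198251530013950333505634304,
  .mkFull 24 3 18 332202359333076247436639068753189728993680930662397244741201989107580928,
  .mkFull 24 4 19 332204149616424039265149942435441827706279687617568330944804071214874624,
  .mkFull 24 4 10 222209146924435032341086561532400003585871853168135750975729196672811008,
  .mkFull 24 6 9 221803062727761098816612491188090215082754530726093328327386727079542784,
  .mkFull 21 3 16 332202464646974854038084854001083387627758703631313233303017786020331520,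
  .mkFull 20 3 8 332664048443855298859431801656469822339431402545582457101369042354176000,
  .mkFull 27 4 22 221774523071108320218711141084677622052569818806090680753877432194498560,
  .mkFull 22 3 8 111808165320846247325099257484926701131642351400212700921356551456948224,
  .mkFull 23 3 10 332204044329742945788340805003316361474844606475607762102078389392375808,
  .mkFull 27 3 21 221774417758716218033758159243967874629607896270421487909848126987567104,
  .mkFull 20 3 15 221777893065948195477745164880414536754619212149225654722432230645432320,
  .mkFull 21 3 14 332257964632846474406396854015500087933210133063507378951442400389758976,
  .mkFull 22 3 17 332204149617930543681642745842625738917395538050815126662590562920693760,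
  .mkFull 27 3 18 221801377729487463857366334245012262804043242911278028896874139066957824,
  .mkFull 24 3 8 111804795327512853495124924108040823589539100162067813660555851258265600,
  .mkFull 27 3 12 221774417784427226741902003652552155821134737664130111911151750371999744,
  .mkFull 24 3 19 221774523072614824635203944491861533263685669239337476471663923900317696,
  .mkFull 24 3 11 221776208120703538966478794288482263555009147745509568830485657125257216,
  .mkFull 24 3 16 222205776929494723454286345180221215802380082617771818109334269924081664,
  .mkFull 24 6 17 111806480300175913373993423534674199539433844014681197101582875013349376,
  .mkFull 24 3 9 221803062751865145056349662792110027291271711648310937687572205868810240,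
  .mkFull 21 3 8 222234421898539579812993000305705616763605986612127221334177723621441536,
  .mkFull 19 3 7 111835125678889538827690975904655765124971296178822251110263794725748736,
  .mkFull 21 3 9 332229319305454431304506234031256988121297364098768595013835332845174784,
  .mkFull 20 3 7 111833440707933850620847653624884219792436045761093848168801944824119296,
  .mkFull 18 3 8 332662468788405178285726362180782685327506049143964335579774757351063552,
  .mkFull 19 3 14 442660736161335453867377987318357791141194405059223470185110458733821952,
  .mkFull 21 4 16 332637193759765170936780440928489585164768211178161873371359395711221760,
  .mkFull 17 3 11 443523349937927372947863428015500092871552068223043954593308965010014208,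
  .mkFull 20 3 14 222209146924435055328519668834129964297664420651431514655742301780967424,
  .mkFull 21 3 7 111831755685556144997716642527769887582868044940677363849463094527066112,
  .mkFull 18 5 7 222236213033464101471002521717700635530707912852380209443717435302805504,
  .mkFull 21 3 17 221774628385006926820156926354872025885179482567143206113553446038929408,
  .mkFull 19 3 8 222236106871102207500809882424183726720492147580497300079855295222906880,
  .mkFull 18 4 6 222691056792356173407164731177111697559922186501527680103370290171674624,
  .mkFull 21 3 15 332231004302121128219493400719699926931291216156852245856103343088336896,
  .mkFull 18 3 7 222261382256582871315584718725434680756934931390736771523084966890242048,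
  .mkFull 16 3 7 222264857565421811227978391479842898447695502440486307188096445244964864,
  .mkFull 16 3 12 443065240673734815649250980116577236761025058093522989039460111729557504,
  .mkFull 17 3 7 332691008829216537114426354761806038477468275513415440577187240665612288,
  .mkFull 15 3 10 443523455277536988257453057672065144983088442832315191055930922264297472,
  .mkFull 15 3 11 442687801831770847554922687601091903316029692605803314114376923462500352,
  .mkFull 15 3 7 332691219453900330843999233166120319029293566107077462378653450791813120,
  .mkFull 14 4 6 333122579013557818551055377549609486355987293841036269584622821723799552,
  .mkFull 13 3 9 443552205558973971225260371501672947750239849023200131288489015053123584]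

/-- Vectors of closed walks of length six that may vanish on a Sidon set. -/
def relVecs : List Vec :=
  [(-1,0,3), (-1,3,0), (0,-1,3), (0,3,-1), (3,-1,0), (3,0,-1), (-2,0,3), (-2,3,0), (-1,-1,3),
   (-1,3,-1), (0,-2,3), (0,3,-2), (1,2,-2), (2,-2,1), (2,1,-2), (3,-2,0), (3,-1,-1), (3,0,-2),
   (-2,-1,3), (-2,3,-1), (-1,-2,3), (-1,3,-2), (0,3,-3), (3,-3,0), (3,-2,-1), (3,-1,-2), (3,0,-3),
   (-1,2,-2), (2,-2,-1), (2,-1,-2), (-2,-1,1), (-2,1,-1), (-1,-2,1), (-1,1,-2), (1,-2,-1),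
   (1,-1,-2), (-3,0,0), (-2,-1,0), (-2,0,-1), (-1,-2,0), (-1,-1,-1), (-1,0,-2), (0,-3,0),
   (0,-2,-1), (0,-1,-2), (0,0,-3)]

/-- Vectors that never vanish on a Sidon set. -/
def badVecs : List Vec :=
  [(0,0,1), (0,0,2), (0,1,-2), (0,1,-1), (0,1,0), (0,1,1), (0,2,-2), (0,2,-1), (0,2,0), (1,-2,0),
   (1,-2,1), (1,-1,-1), (1,-1,0), (1,-1,1), (1,0,-2), (1,0,-1), (1,0,0), (1,0,1), (1,1,-2),
   (1,1,-1), (1,1,0), (2,-2,0), (2,-1,-1), (2,-1,0), (2,0,-2), (2,0,-1), (2,0,0)]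

/-- The ordered pairs of distinct indices. -/
def offDiag : List (Fin 4 × Fin 4) :=
  [(0,1), (0,2), (0,3), (1,0), (1,2), (1,3), (2,0), (2,1), (2,3), (3,0), (3,1), (3,2)]

/-- Too many differences are killed by `E`. -/
def torsionCheck (B : Rows) (E : ℕ) : Bool :=
  Nat.ble E (offDiag.countP fun x =>
    B.mem (subMul (subMul (0, 0, 0) E (unitVec x.2)) (-E) (unitVec x.1)))

/-- Check the certificate `h` for a set of relations with rows `B`. -/
def hintCheck (L : List Pattern) (B : Rows) (h : ℕ) : Bool :=
  bif h == 0 then badVecs.any fun w => B.mem w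
  else bif Nat.blt h 13 then torsionCheck B h
  else match L[(h - 13) / 24]?, permCodes[(h - 13) % 24]? with
    | some Q, some p => Q.gens.all fun w => B.mem (permVec p w)
    | _, _ => false

/-- Check the successors of a pattern. -/
def childCheck (L : List Pattern) (P : Pattern) : List Vec → ℕ → Bool
  | [], _ => true
  | u :: l, ch =>
    (bif P.sat P.n u then P.rows.mem u
      else hintCheck L (P.rows.insert u) (ch % 2048)) && childCheck L P l (ch / 2048)

/-- Check that the order of `F 1 - F 0` can only be `n`, or leads to a pattern in `L`. -/
def orderCheck (L : List Pattern) (P : Pattern) (m : ℕ) : Bool :=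
  !(P.n % m == 0) || (badVecs.any fun w => P.sat m w) ||
    L.any fun Q => Q.n == m && Q.s1 == P.s1 && Q.s2 == P.s2 && Q.s3 == P.s3

/-- Check a pattern, with later patterns `L`. -/
def nodeCheck (L : List Pattern) (P : Pattern) : Bool :=
  bif P.full then
    !(P.n == 0) && P.s1 == 1 && (List.range P.n).all fun m => m == 0 || orderCheck L P m
  else (badVecs.all fun w => !P.sat P.n w) && childCheck L P relVecs P.children

/-- Check a list of patterns. -/
def treeCheck : List Pattern → Bool
  | [] => true
  | P :: L => nodeCheck L P && treeCheck L

/-- The three letters different from a given one. -/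
def others : ℕ → List ℕ
  | 0 => [1, 2, 3]
  | 1 => [0, 2, 3]
  | 2 => [0, 1, 3]
  | _ => [0, 1, 2]

/-- The letters. -/
def letters : List ℕ := [0, 1, 2, 3]

/-- The ends of the walks of length three in the sample. -/
def Pattern.ends (P : Pattern) : List ℕ :=
  letters.flatMap fun d => letters.flatMap fun e => letters.map fun f =>
    (P.s d + P.s f + (P.n - P.s e)) % P.n

/-- Check the table of a pattern. -/
def tableCheck (P : Pattern) : Bool :=
  letters.all (fun k => Nat.ble (P.s k) P.n) &&
  letters.all fun a => (others a).all fun c => (others a).all fun b =>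
    (P.entry c a b).beq (P.ends.countP ((P.s c + P.s b + (P.n - P.s a)) % P.n).beq)

/-- An invariant of a pattern. -/
def Pattern.prof (P : Pattern) : ℕ :=
  (letters.map fun a => ((others a).map fun c => ((others a).map fun b =>
    2 ^ (6 * P.entry c a b)).sum).sum).sum

/-- Whether an isomorphism may induce `p` on the points of a line and `q` on the lines of the
`a`-th point of it. -/
def edge (P Q : Pattern) (a p q : ℕ) : Bool :=
  (dig p a).beq (dig q a) && (others a).all fun c => (others a).all fun b =>
    (P.entry c a b).beq (Q.entry (dig p c) (dig p a) (dig q b))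

/-- The hexagon with directions `a, b, c, a, b, c` excludes `p` and `q` at its first edge. -/
def hexagonCheck (P Q : Pattern) (a p q b c : ℕ) : Bool :=
  permCodes.all fun r₂ => !edge P Q b r₂ q || permCodes.all fun r₃ => !edge P Q c r₂ r₃ ||
    permCodes.all fun r₄ => !edge P Q a r₄ r₃ || permCodes.all fun r₅ => !edge P Q b r₄ r₅ ||
      !edge P Q c p r₅ || !Q.rel (dig q a) (dig q b) (dig r₂ c) (dig r₃ a) (dig r₄ b) (dig r₅ c)

/-- The permutations mapping `a` to `x`. -/
def fiber (a x : ℕ) : List ℕ := permCodes.filter fun p => (dig p a).beq x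

/-- Only `p = q` is possible in `edge`. -/
def rigidCheck (P Q : Pattern) : Bool :=
  letters.all fun a => letters.all fun x => (fiber a x).all fun p => (fiber a x).all fun q =>
    p.beq q || !edge P Q a p q ||
      (others a).any fun b => (others a).any fun c => !b.beq c && hexagonCheck P Q a p q b c

/-- Check that two patterns with isomorphic configurations are affinely equivalent. -/
def pairCheck (P Q : Pattern) : Bool :=
  !P.prof.beq Q.prof || (P.full && Q.full && P.n == Q.n && P.s2 == Q.s2 && P.s3 == Q.s3) ||
    rigidCheck P Q

theorem treeCheck_patterns : treeCheck patterns = true := by decide +kernel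

theorem tableCheck_patterns : patterns.all tableCheck = true := by decide +kernel

theorem pairCheck_patterns :
    (patterns.all fun P => patterns.all fun Q => pairCheck P Q) = true := by
  decide +kernel

section Linear

variable {A : Type*} [AddCommGroup A]

/-- The evaluation of coefficient vectors at a family of four elements. -/
def evalVec (F : Fin 4 → A) : Vec →+ A where
  toFun w := w.1 • (F 1 - F 0) + w.2.1 • (F 2 - F 0) + w.2.2 • (F 3 - F 0)
  map_zero' := by simp
  map_add' w w' := by
    simp only [Prod.fst_add, Prod.snd_add, add_smul]
    abel

theorem evalVec_apply (F : Fin 4 → A) (w : Vec) :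
    evalVec F w = w.1 • (F 1 - F 0) + w.2.1 • (F 2 - F 0) + w.2.2 • (F 3 - F 0) := rfl

theorem evalVec_unitVec (F : Fin 4 → A) (k : Fin 4) : evalVec F (unitVec k) = F k - F 0 := by
  fin_cases k <;> simp [unitVec, evalVec_apply]

theorem subMul_eq (w : Vec) (q : ℤ) (r : Vec) : subMul w q r = w - q • r := by
  ext <;> simp [subMul]

theorem map_subMul (φ : Vec →+ A) (w : Vec) (q : ℤ) (r : Vec) :
    φ (subMul w q r) = φ w - q • φ r := by
  rw [subMul_eq, map_sub, map_zsmul]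

/-- The rows are in the kernel of `φ`. -/
def Rows.Killed (B : Rows) (φ : Vec →+ A) : Prop :=
  φ B.1 = 0 ∧ φ B.2.1 = 0 ∧ φ B.2.2 = 0

theorem Rows.Killed.map_eq_zero {B : Rows} {φ : Vec →+ A} (hB : B.Killed φ) {w : Vec}
    (hw : B.mem w = true) : φ w = 0 := by
  obtain ⟨h₁, h₂, h₃⟩ := hB
  have key : ∀ q₁ q₂ q₃ : ℤ,
      φ (subMul (subMul (subMul w q₁ B.1) q₂ B.2.1) q₃ B.2.2) = φ w := by
    intro q₁ q₂ q₃
    simp [map_subMul, h₁, h₂, h₃]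
  simp only [Rows.mem, Bool.and_eq_true, beq_iff_eq] at hw
  rw [← key, ← map_zero φ]
  congr 1
  exact Prod.ext hw.1.1 (Prod.ext hw.1.2 hw.2)

theorem map_euclid (φ : Vec →+ A) (c : Vec → ℤ) (fuel : ℕ) :
    ∀ r w : Vec, φ r = 0 → φ w = 0 →
      φ (euclid c fuel r w).1 = 0 ∧ φ (euclid c fuel r w).2 = 0 := by
  induction fuel with
  | zero => exact fun r w hr hw => ⟨hr, hw⟩
  | succ fuel ih =>
    intro r w hr hw
    rw [euclid]
    split
    · exact ⟨hr, hw⟩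
    · exact ih _ _ hw (by simp [map_subMul, hr, hw])

theorem Rows.Killed.insert {B : Rows} {φ : Vec →+ A} (hB : B.Killed φ) {w : Vec}
    (hw : φ w = 0) : (B.insert w).Killed φ := by
  obtain ⟨h₁, h₂, h₃⟩ := hB
  have k₁ := map_euclid φ (fun w => w.1) 8 B.1 w h₁ hw
  have k₂ := map_euclid φ (fun w => w.2.1) 8 B.2.1 _ h₂ k₁.2
  have k₃ := map_euclid φ (fun w => w.2.2) 8 B.2.2 _ h₃ k₂.2
  exact ⟨k₁.1, k₂.1, k₃.1⟩

/-- The map with a given code. -/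
def decode (p : ℕ) (k : Fin 4) : Fin 4 := ⟨dig p k, Nat.mod_lt _ (by norm_num)⟩

theorem evalVec_permVec (F : Fin 4 → A) (p : ℕ) (w : Vec) :
    evalVec F (permVec p w) = evalVec (F ∘ decode p) w := by
  have h (k : Fin 4) : evalVec F (unitVec (dig p k)) = F (decode p k) - F 0 :=
    evalVec_unitVec F (decode p k)
  have h₀ := h 0
  have h₁ := h 1
  have h₂ := h 2
  have h₃ := h 3
  simp only [Fin.val_zero, Fin.val_one, Fin.val_two, show ((3 : Fin 4) : ℕ) = 3 from rfl]
    at h₀ h₁ h₂ h₃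
  rw [permVec]
  simp only [map_subMul, h₀, h₁, h₂, h₃, evalVec_apply (F ∘ decode p), Function.comp_apply]
  rw [show ((0, 0, 0) : Vec) = 0 from rfl, map_zero]
  module

/-- A family of four elements with distinct differences. -/
def Sidon (F : Fin 4 → A) : Prop :=
  ∀ a b c d, F a + F c = F b + F d → a = b ∨ a = d

theorem Sidon.injective {F : Fin 4 → A} (hF : Sidon F) : Function.Injective F := fun a b h =>
  (hF a b b b (by rw [h])).elim id id

theorem Sidon.comp {F : Fin 4 → A} (hF : Sidon F) {π : Fin 4 → Fin 4} (hπ : π.Injective) :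
    Sidon (F ∘ π) := fun a b c d h =>
  (hF (π a) (π b) (π c) (π d) h).imp (fun h => hπ h) fun h => hπ h

theorem badVecs_spec : ∀ w ∈ badVecs, ∃ a b c d : Fin 4, a ≠ b ∧ a ≠ d ∧
    w = unitVec a - unitVec b + unitVec c - unitVec d := by
  decide +kernel

theorem Sidon.evalVec_ne_zero {F : Fin 4 → A} (hF : Sidon F) {w : Vec} (hw : w ∈ badVecs) :
    evalVec F w ≠ 0 := by
  obtain ⟨a, b, c, d, hab, had, rfl⟩ := badVecs_spec w hw
  simp only [map_sub, map_add, evalVec_unitVec]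
  intro h
  refine (hF a b c d ?_).elim hab had
  rw [← sub_eq_zero, ← h]
  abel

/-- The vector of a closed walk of length six. -/
def walkVec (a b c d e f : Fin 4) : Vec :=
  unitVec a + unitVec c + unitVec e - (unitVec b + unitVec d + unitVec f)

theorem evalVec_walkVec_eq_zero_iff (F : Fin 4 → A) (a b c d e f : Fin 4) :
    evalVec F (walkVec a b c d e f) = 0 ↔ F a + F c + F e = F b + F d + F f := by
  simp only [walkVec, map_sub, map_add, evalVec_unitVec]
  rw [← sub_eq_zero (a := F a + F c + F e)]
  apply Eq.congr_left
  abel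

/-- Sums of three unit vectors. -/
def tripleVecs : List Vec :=
  [(0,0,0), (0,0,1), (0,0,2), (0,0,3), (0,1,0), (0,1,1), (0,1,2), (0,2,0), (0,2,1), (0,3,0),
   (1,0,0), (1,0,1), (1,0,2), (1,1,0), (1,1,1), (1,2,0), (2,0,0), (2,0,1), (2,1,0), (3,0,0)]

theorem sum_mem_tripleVecs : ∀ a b c : Fin 4,
    unitVec a + unitVec b + unitVec c ∈ tripleVecs := by
  decide +kernel

theorem sub_mem_of_mem_tripleVecs : ∀ x ∈ tripleVecs, ∀ y ∈ tripleVecs,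
    x = y ∨ x - y ∈ relVecs ∨ y - x ∈ relVecs ∨ x - y ∈ badVecs ∨ y - x ∈ badVecs := by
  decide +kernel

theorem walkVec_mem (a b c d e f : Fin 4) :
    walkVec a b c d e f = 0 ∨ walkVec a b c d e f ∈ relVecs ∨ -walkVec a b c d e f ∈ relVecs ∨
      walkVec a b c d e f ∈ badVecs ∨ -walkVec a b c d e f ∈ badVecs := by
  have := sub_mem_of_mem_tripleVecs _ (sum_mem_tripleVecs a c e) _ (sum_mem_tripleVecs b d f)
  rwa [← sub_eq_zero (b := unitVec b + _ + _), ← neg_sub (unitVec a + _ + _)] at this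

theorem mem_permCodes_of_injective : ∀ p : Fin 4 → Fin 4, p.Injective →
    ∃ q ∈ permCodes, decode q = p := by
  have h : ∀ a b c d : Fin 4, Function.Injective ![a, b, c, d] →
      ∃ q ∈ permCodes, ∀ k, decode q k = ![a, b, c, d] k := by decide +kernel
  intro p hp
  have hp' : p = ![p 0, p 1, p 2, p 3] := by ext k; fin_cases k <;> rfl
  obtain ⟨q, hq, hk⟩ := h (p 0) (p 1) (p 2) (p 3) (hp' ▸ hp)
  exact ⟨q, hq, by rw [hp']; exact funext hk⟩

theorem decode_injective : ∀ p ∈ permCodes, (decode p).Injective := by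
  decide +kernel

end Linear

section Classification

variable {A : Type*} [AddCommGroup A]

theorem Pattern.sat_iff (P : Pattern) (m : ℕ) (w : Vec) :
    P.sat m w = true ↔ (m : ℤ) ∣ w.1 * P.s1 + w.2.1 * P.s2 + w.2.2 * P.s3 := by
  simp only [Pattern.sat, beq_iff_eq]
  exact Int.dvd_iff_emod_eq_zero.symm

theorem Pattern.sat_iff_dvd_evalVec (P : Pattern) (m : ℕ) (w : Vec) :
    P.sat m w = true ↔ (m : ℤ) ∣ evalVec (fun k : Fin 4 => (P.s k : ℤ)) w := by
  rw [P.sat_iff]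
  simp [evalVec_apply, Pattern.s]

theorem Pattern.rel_iff (P : Pattern) (a b c d e f : ℕ) :
    P.rel a b c d e f = true ↔ P.s a + P.s c + P.s e ≡ P.s b + P.s d + P.s f [MOD P.n] := by
  simp [Pattern.rel, Nat.ModEq]

theorem Pattern.sat_walkVec (P : Pattern) (a b c d e f : Fin 4) :
    P.sat P.n (walkVec a b c d e f) = true ↔ P.rel a b c d e f = true := by
  rw [P.sat_iff_dvd_evalVec, P.rel_iff, Nat.ModEq.comm, ← Int.natCast_modEq_iff,
    Int.modEq_iff_dvd]
  congr! 1
  simp only [walkVec, map_sub, map_add, evalVec_unitVec]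
  push_cast
  ring

/-- The family `F` has the pattern `P`. -/
def Realizes (F : Fin 4 → A) (P : Pattern) : Prop :=
  (∀ a b c d e f : Fin 4,
    F a + F c + F e = F b + F d + F f ↔ P.rel a b c d e f = true) ∧
  (P.full = true → ∃ t : A, addOrderOf t = P.n ∧ ∀ k, F k = F 0 + P.s k • t)

/-- The family `F` has one of the patterns in `L`, up to relabelling. -/
def Classified (F : Fin 4 → A) (L : List Pattern) : Prop :=
  ∃ π : Fin 4 → Fin 4, π.Injective ∧ ∃ P ∈ L, Realizes (F ∘ π) P

theorem Classified.of_comp {F : Fin 4 → A} {L : List Pattern} {π : Fin 4 → Fin 4}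
    (hπ : π.Injective) (h : Classified (F ∘ π) L) : Classified F L := by
  obtain ⟨π', hπ', h⟩ := h
  exact ⟨π ∘ π', hπ.comp hπ', h⟩

theorem Classified.cons {F : Fin 4 → A} {L : List Pattern} (h : Classified F L) (P : Pattern) :
    Classified F (P :: L) := by
  obtain ⟨π, hπ, Q, hQ, h⟩ := h
  exact ⟨π, hπ, Q, List.mem_cons_of_mem P hQ, h⟩

theorem realizes_of_addOrderOf [Finite A] {F : Fin 4 → A} {P : Pattern} {t : A}
    (ht : addOrderOf t = P.n) (h : ∀ k, F k = F 0 + P.s k • t) : Realizes F P := by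
  refine ⟨fun a b c d e f => ?_, fun _ => ⟨t, ht, h⟩⟩
  have key (x y z : Fin 4) : F x + F y + F z = 3 • F 0 + (P.s x + P.s y + P.s z) • t := by
    rw [h x, h y, h z]
    module
  rw [P.rel_iff, ← ht, ← (isOfFinAddOrder_of_finite t).nsmul_eq_nsmul_iff_modEq, key, key,
    add_right_inj]

theorem realizes_of_sat {F : Fin 4 → A} (hF : Sidon F) {P : Pattern} (hfull : P.full = false)
    (hbad : ∀ w ∈ badVecs, P.sat P.n w = false)
    (h : ∀ u ∈ relVecs, evalVec F u = 0 ↔ P.sat P.n u = true) : Realizes F P := by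
  refine ⟨fun a b c d e f => ?_, by simp [hfull]⟩
  rw [← evalVec_walkVec_eq_zero_iff, ← P.sat_walkVec]
  have hneg (w : Vec) : P.sat P.n (-w) = true ↔ P.sat P.n w = true := by
    rw [P.sat_iff_dvd_evalVec, P.sat_iff_dvd_evalVec, map_neg, dvd_neg]
  have hneg' (w : Vec) : evalVec F (-w) = 0 ↔ evalVec F w = 0 := by rw [map_neg, neg_eq_zero]
  have hbad' (w : Vec) (hw : w ∈ badVecs) : evalVec F w = 0 ↔ P.sat P.n w = true := by
    simp [hbad w hw, hF.evalVec_ne_zero hw]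
  obtain h₀ | h₁ | h₁ | h₁ | h₁ := walkVec_mem a b c d e f
  · rw [h₀]
    simp [P.sat_iff]
  · exact h _ h₁
  · rw [← hneg, ← hneg']
    exact h _ h₁
  · exact hbad' _ h₁
  · rw [← hneg, ← hneg']
    exact hbad' _ h₁

theorem Sidon.not_torsionCheck [Finite A] [IsAddCyclic A] {F : Fin 4 → A} (hF : Sidon F) {B : Rows}
    (hB : B.Killed (evalVec F)) {E : ℕ} (hE : 0 < E) : torsionCheck B E = false := by
  classical
  have := Fintype.ofFinite A
  by_contra hc
  rw [Bool.not_eq_false, torsionCheck, Nat.ble_eq, List.countP_eq_length_filter] at hc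
  set l := offDiag.filter _ with hl
  have hl' : ∀ x ∈ l, x.1 ≠ x.2 ∧ E • (F x.1 - F x.2) = 0 := by
    intro x hx
    obtain ⟨hx₁, hx₂⟩ := List.mem_filter.1 hx
    have hx₃ := hB.map_eq_zero hx₂
    rw [show ((0, 0, 0) : Vec) = 0 from rfl] at hx₃
    simp only [map_subMul, evalVec_unitVec, map_zero] at hx₃
    refine ⟨(by decide : ∀ x ∈ offDiag, x.1 ≠ x.2) x hx₁, ?_⟩
    rw [← hx₃, ← natCast_zsmul]
    module
  have hinj : Set.InjOn (fun x : Fin 4 × Fin 4 => F x.1 - F x.2) (l.toFinset : Set _) := by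
    intro x hx y hy hxy
    have hx' := (hl' x (List.mem_toFinset.1 hx)).1
    have h' : F x.1 + F y.2 = F x.2 + F y.1 := by
      have := sub_eq_sub_iff_add_eq_add.1 hxy
      rw [this, add_comm]
    obtain h | h := hF _ _ _ _ h'
    · exact absurd h hx'
    · rw [h, add_comm, add_left_inj] at h'
      exact Prod.ext h (hF.injective h').symm
  have hsub : insert 0 (l.toFinset.image fun x => F x.1 - F x.2) ⊆
      Finset.univ.filter fun a : A => E • a = 0 := by
    intro a ha
    rw [Finset.mem_insert, Finset.mem_image] at ha
    rw [Finset.mem_filter]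
    refine ⟨Finset.mem_univ a, ?_⟩
    obtain rfl | ⟨x, hx, rfl⟩ := ha
    · exact smul_zero E
    · exact (hl' x (List.mem_toFinset.1 hx)).2
  have h0 : (0 : A) ∉ l.toFinset.image fun x => F x.1 - F x.2 := by
    rw [Finset.mem_image]
    rintro ⟨x, hx, hx0⟩
    exact (hl' x (List.mem_toFinset.1 hx)).1 (hF.injective (sub_eq_zero.1 hx0))
  have hnodup : l.Nodup := List.Nodup.filter _ (by decide)
  have hcard := (Finset.card_le_card hsub).trans (IsAddCyclic.card_nsmul_eq_zero_le hE)
  rw [Finset.card_insert_of_notMem h0, Finset.card_image_of_injOn hinj,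
    List.toFinset_card_of_nodup hnodup] at hcard
  omega

theorem Sidon.classified_of_full [Finite A] {L : List Pattern} {F : Fin 4 → A} (hF : Sidon F)
    {P : Pattern} (hfull : P.full = true) (hc : nodeCheck L P = true)
    (hP : ∀ w ∈ P.gens, evalVec F w = 0) : Classified F (P :: L) := by
  rw [nodeCheck, hfull, cond_true, Bool.and_eq_true, Bool.and_eq_true, beq_iff_eq] at hc
  obtain ⟨⟨hn₀, hs⟩, hc⟩ := hc
  simp only [Pattern.gens, hfull, cond_true, List.forall_mem_cons, evalVec_apply] at hP
  set t := F 1 - F 0 with ht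
  have hn : P.n • t = 0 := by simpa using hP.1
  have h₂ : F 2 = F 0 + P.s2 • t := by
    have := hP.2.1
    simp only [natCast_zsmul, neg_smul, one_smul, zero_smul, add_zero] at this
    rw [add_neg_eq_zero.1 this]
    abel
  have h₃ : F 3 = F 0 + P.s3 • t := by
    have := hP.2.2.1
    simp only [natCast_zsmul, neg_smul, one_smul, zero_smul, add_zero] at this
    rw [add_neg_eq_zero.1 this]
    abel
  have h (Q : Pattern) (h1 : Q.s1 = P.s1) (h2 : Q.s2 = P.s2) (h3 : Q.s3 = P.s3) (k : Fin 4) :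
      F k = F 0 + Q.s k • t := by
    fin_cases k
    · simp [Pattern.s]
    · simp [Pattern.s, h1, hs, ht]
    · simpa [Pattern.s, h2] using h₂
    · simpa [Pattern.s, h3] using h₃
  have hdvd : addOrderOf t ∣ P.n := addOrderOf_dvd_of_nsmul_eq_zero hn
  have hn₁ : P.n ≠ 0 := by simpa using hn₀
  obtain hm | hm := (Nat.le_of_dvd (Nat.pos_of_ne_zero hn₁) hdvd).eq_or_lt
  · exact ⟨id, Function.injective_id, P, List.mem_cons_self,
      realizes_of_addOrderOf hm (h P rfl rfl rfl)⟩
  have hc := List.all_eq_true.1 hc _ (List.mem_range.2 hm)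
  simp only [orderCheck, Bool.or_eq_true, Bool.not_eq_true', beq_eq_false_iff_ne, beq_iff_eq,
    Bool.and_eq_true, (addOrderOf_pos t).ne', Nat.mod_eq_zero_of_dvd hdvd, ne_eq,
    not_true_eq_false, false_or, List.any_eq_true] at hc
  obtain ⟨w, hw, hPw⟩ | ⟨Q, hQ, ⟨⟨hm', h1⟩, h2⟩, h3⟩ := hc
  · refine absurd ?_ (hF.evalVec_ne_zero hw)
    rw [P.sat_iff, addOrderOf_dvd_iff_zsmul_eq_zero, hs] at hPw
    rw [evalVec_apply, h₂, h₃, ← ht, ← hPw]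
    push_cast
    module
  · exact ⟨id, Function.injective_id, Q, List.mem_cons_of_mem P hQ,
      realizes_of_addOrderOf hm'.symm (h Q h1 h2 h3)⟩

/-- Every family killing the relations of a pattern in `L` is classified by `L`. -/
def Classifies (A : Type*) [AddCommGroup A] (L : List Pattern) : Prop :=
  ∀ F : Fin 4 → A, Sidon F → ∀ P ∈ L, (∀ w ∈ P.gens, evalVec F w = 0) → Classified F L

variable [Finite A] [IsAddCyclic A]

theorem Classifies.of_hintCheck {L : List Pattern} (hL : Classifies A L) {F : Fin 4 → A}
    (hF : Sidon F) {B : Rows} (hB : B.Killed (evalVec F)) {h : ℕ}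
    (hc : hintCheck L B h = true) : Classified F L := by
  rw [hintCheck, Bool.cond_eq_ite, Bool.cond_eq_ite] at hc
  split_ifs at hc with h₁ h₂
  · obtain ⟨w, hw, hBw⟩ := List.any_eq_true.1 hc
    exact absurd (hB.map_eq_zero hBw) (hF.evalVec_ne_zero hw)
  · rw [hF.not_torsionCheck hB (Nat.pos_of_ne_zero (by simpa using h₁))] at hc
    exact absurd hc (by decide)
  · split at hc
    · next Q p hQ hp =>
      have hp' := decode_injective p (List.mem_of_getElem? hp)
      refine .of_comp hp' (hL _ (hF.comp hp') Q (List.mem_of_getElem? hQ) fun w hw => ?_)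
      rw [← evalVec_permVec]
      exact hB.map_eq_zero (List.all_eq_true.1 hc w hw)
    · exact absurd hc (by decide)

theorem Classifies.of_childCheck {L : List Pattern} (hL : Classifies A L) {F : Fin 4 → A}
    (hF : Sidon F) {P : Pattern} (hP : P.rows.Killed (evalVec F)) (l : List Vec) :
    ∀ ch : ℕ, childCheck L P l ch = true →
      Classified F L ∨ ∀ u ∈ l, evalVec F u = 0 ↔ P.sat P.n u = true := by
  induction l with
  | nil => exact fun _ _ => .inr (by simp)
  | cons u l ih =>
    intro ch hc
    rw [childCheck, Bool.and_eq_true, Bool.cond_eq_ite] at hc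
    split_ifs at hc with hu
    · refine (ih _ hc.2).imp_right fun hl => List.forall_mem_cons.2 ⟨?_, hl⟩
      simp [hu, hP.map_eq_zero hc.1]
    · by_cases hFu : evalVec F u = 0
      · exact .inl (hL.of_hintCheck hF (hP.insert hFu) hc.1)
      · refine (ih _ hc.2).imp_right fun hl => List.forall_mem_cons.2 ⟨?_, hl⟩
        simp [hu, hFu]

theorem Classifies.of_not_full {L : List Pattern} (hL : Classifies A L) {F : Fin 4 → A}
    (hF : Sidon F) {P : Pattern} (hfull : P.full = false) (hc : nodeCheck L P = true)
    (hP : ∀ w ∈ P.gens, evalVec F w = 0) : Classified F (P :: L) := by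
  rw [nodeCheck, hfull, cond_false, Bool.and_eq_true, List.all_eq_true] at hc
  simp only [Pattern.gens, hfull, cond_false, List.forall_mem_cons] at hP
  obtain h | h := hL.of_childCheck hF ⟨hP.1, hP.2.1, hP.2.2.1⟩ relVecs P.children hc.2
  · exact h.cons P
  · exact ⟨id, Function.injective_id, P, List.mem_cons_self,
      realizes_of_sat hF hfull (fun w hw => by simpa using hc.1 w hw) h⟩

theorem classifies_of_treeCheck (L : List Pattern) (hc : treeCheck L = true) :
    Classifies A L := by
  induction L with
  | nil => exact fun F _ P hP => absurd hP List.not_mem_nil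
  | cons P L ih =>
    rw [treeCheck, Bool.and_eq_true] at hc
    have hL := ih hc.2
    intro F hF Q hQ hQF
    obtain rfl | hQ := List.mem_cons.1 hQ
    · cases hfull : Q.full
      · exact hL.of_not_full hF hfull hc.1 hQF
      · exact hF.classified_of_full hfull hc.1 hQF
    · exact (hL F hF Q hQ hQF).cons P

theorem Sidon.classified {F : Fin 4 → A} (hF : Sidon F) : Classified F patterns := by
  have h : ∃ P ∈ patterns, ∀ w ∈ P.gens, w = 0 := by decide +kernel
  obtain ⟨P, hP, hw⟩ := h
  exact classifies_of_treeCheck patterns treeCheck_patterns F hF P hP fun w h => by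
    rw [hw w h, map_zero]

end Classification

section Flags

variable {A : Type*} [AddCommGroup A]

/-- The position of the end of a walk of length three. -/
def endPos (F : Fin 4 → A) (t : Fin 4 × Fin 4 × Fin 4) : A :=
  F t.1 - F t.2.1 + F t.2.2

open Classical in
/-- The number of walks of length three with the same end. -/
noncomputable def walkCount (F : Fin 4 → A) (t : Fin 4 × Fin 4 × Fin 4) : ℕ :=
  Finset.card {u | endPos F u = endPos F t}

/-- The sum of `2 ^ (6 * walkCount F t)` over the walks without backtracking. -/
noncomputable def profile (F : Fin 4 → A) : ℕ :=
  ∑ t : Fin 4 × Fin 4 × Fin 4 with t.1 ≠ t.2.1 ∧ t.2.2 ≠ t.2.1, 2 ^ (6 * walkCount F t)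

/-- An isomorphism of the cyclic configurations with base lines `F` and `G`, where the `k`-th point
of the line `i` is mapped to the `ρ i k`-th point of the line `τ i`. -/
structure FlagIso (F G : Fin 4 → A) where
  σ : A → A
  τ : A → A
  τ_injective : τ.Injective
  σ_injective : σ.Injective
  ρ : A → Fin 4 → Fin 4
  σ_add : ∀ i k, σ (i + F k) = τ i + G (ρ i k)

namespace FlagIso

variable {F G : Fin 4 → A} (I : FlagIso F G)

/-- The map induced on the lines through a point. -/
def κ (x : A) (k : Fin 4) : Fin 4 := I.ρ (x - F k) k

theorem κ_add (i : A) (k : Fin 4) : I.κ (i + F k) k = I.ρ i k := by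
  rw [κ, add_sub_cancel_right]

theorem τ_sub (x : A) (k : Fin 4) : I.τ (x - F k) = I.σ x - G (I.κ x k) := by
  have := I.σ_add (x - F k) k
  rw [sub_add_cancel] at this
  rw [this, κ, add_sub_cancel_right]

theorem ρ_injective (hF : F.Injective) (i : A) : (I.ρ i).Injective := fun k l h =>
  hF (add_right_injective i (I.σ_injective (by simp only [I.σ_add, h])))

theorem κ_injective (hF : F.Injective) (x : A) : (I.κ x).Injective := fun k l h =>
  hF (sub_right_injective (b := x) (I.τ_injective (by simp only [I.τ_sub, h])))

/-- The map induced on walks of length three starting at `y`. -/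
def mapWalk (y : A) (t : Fin 4 × Fin 4 × Fin 4) : Fin 4 × Fin 4 × Fin 4 :=
  (I.κ y t.1, I.ρ (y - F t.1) t.2.1, I.κ (y - F t.1 + F t.2.1) t.2.2)

theorem τ_sub_endPos (y : A) (t : Fin 4 × Fin 4 × Fin 4) :
    I.τ (y - endPos F t) = I.σ y - endPos G (I.mapWalk y t) := by
  have : y - endPos F t = y - F t.1 + F t.2.1 - F t.2.2 := by
    rw [endPos]
    abel
  rw [this, I.τ_sub, I.σ_add, I.τ_sub, endPos, mapWalk]
  abel

theorem mapWalk_bijective (hF : F.Injective) (y : A) : (I.mapWalk y).Bijective := by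
  refine Finite.injective_iff_bijective.1 ?_
  rintro ⟨a, b, c⟩ ⟨a', b', c'⟩ h
  simp only [mapWalk, Prod.mk.injEq] at h
  obtain ⟨h₁, h₂, h₃⟩ := h
  obtain rfl := I.κ_injective hF _ h₁
  obtain rfl := I.ρ_injective hF _ h₂
  obtain rfl := I.κ_injective hF _ h₃
  rfl

theorem mapWalk_proper (hF : F.Injective) (y : A) (t : Fin 4 × Fin 4 × Fin 4) :
    ((I.mapWalk y t).1 ≠ (I.mapWalk y t).2.1 ∧ (I.mapWalk y t).2.2 ≠ (I.mapWalk y t).2.1) ↔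
      t.1 ≠ t.2.1 ∧ t.2.2 ≠ t.2.1 := by
  simp only [mapWalk]
  nth_rw 2 [← I.κ_add]
  rw [κ, (I.ρ_injective hF _).ne_iff, (I.κ_injective hF _).ne_iff]

theorem walkCount_mapWalk (hF : F.Injective) (y : A) (t : Fin 4 × Fin 4 × Fin 4) :
    walkCount G (I.mapWalk y t) = walkCount F t := by
  classical
  symm
  refine Finset.card_equiv (Equiv.ofBijective _ (I.mapWalk_bijective hF y)) fun u => ?_
  simp only [Finset.mem_filter, Finset.mem_univ, true_and, Equiv.ofBijective_apply]
  rw [← sub_right_inj (a := I.σ y) (b := endPos G _), ← I.τ_sub_endPos, ← I.τ_sub_endPos,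
    I.τ_injective.eq_iff, sub_right_inj]

theorem profile_eq (I : FlagIso F G) (hF : F.Injective) : profile F = profile G := by
  refine Finset.sum_equiv (Equiv.ofBijective _ (I.mapWalk_bijective hF 0)) (fun t => ?_)
    fun t _ => ?_
  · simp only [Finset.mem_filter, Finset.mem_univ, true_and, Equiv.ofBijective_apply]
    exact (I.mapWalk_proper hF 0 t).symm
  · rw [Equiv.ofBijective_apply, I.walkCount_mapWalk hF]

theorem walkCount_eq (hF : F.Injective) (i : A) (c a b : Fin 4) :
    walkCount F (c, a, b) = walkCount G (I.ρ i c, I.ρ i a, I.κ (i + F a) b) := by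
  rw [← I.walkCount_mapWalk hF (i + F c), mapWalk]
  simp only [I.κ_add, add_sub_cancel_right]

end FlagIso

theorem Realizes.endPos_eq_iff {F : Fin 4 → A} {P : Pattern} (h : Realizes F P)
    (hs : ∀ k : Fin 4, P.s k ≤ P.n) (t u : Fin 4 × Fin 4 × Fin 4) : endPos F t = endPos F u ↔
      (P.s u.1 + P.s u.2.2 + (P.n - P.s u.2.1)) % P.n =
        (P.s t.1 + P.s t.2.2 + (P.n - P.s t.2.1)) % P.n := by
  have key := h.1 t.1 u.1 t.2.2 u.2.2 u.2.1 t.2.1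
  rw [P.rel_iff] at key
  have h₁ := hs t.2.1
  have h₂ := hs u.2.1
  have : endPos F t = endPos F u ↔ F t.1 + F t.2.2 + F u.2.1 = F u.1 + F u.2.2 + F t.2.1 := by
    rw [← sub_eq_zero, ← sub_eq_zero (a := F t.1 + F t.2.2 + F u.2.1), endPos, endPos]
    apply Eq.congr_left
    abel
  rw [this, key]
  change _ ↔ _ ≡ _ [MOD P.n]
  rw [Nat.ModEq.comm]
  constructor
  · intro h
    refine Nat.ModEq.add_right_cancel' (P.s t.2.1 + P.s u.2.1) ?_
    have := h.add_right P.n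
    convert this using 1 <;> omega
  · intro h
    refine Nat.ModEq.add_right_cancel' P.n ?_
    have := h.add_right (P.s t.2.1 + P.s u.2.1)
    convert this using 1 <;> omega

theorem sum_map_letters (f : ℕ → ℕ) : (letters.map f).sum = ∑ k : Fin 4, f k := by
  simp [letters, Fin.sum_univ_four, add_assoc]

theorem sum_map_others (a : Fin 4) (f : ℕ → ℕ) :
    ((others a).map f).sum = ∑ k : Fin 4, if k ≠ a then f k else 0 := by
  fin_cases a <;> simp [others, Fin.sum_univ_four, add_assoc]

theorem card_filter_eq_countP (g : ℕ → ℕ → ℕ → ℕ) (q : ℕ → Bool) :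
    Finset.card {u : Fin 4 × Fin 4 × Fin 4 | q (g u.1 u.2.1 u.2.2) = true} =
      (letters.flatMap fun d => letters.flatMap fun e => letters.map fun f => g d e f).countP q := by
  have h (g : ℕ → ℕ) : (letters.map g).countP q =
      ∑ k : Fin 4, if q (g k) = true then 1 else 0 := by
    simp [← sum_map_letters fun k => if q (g k) = true then 1 else 0, letters, List.countP_cons,
      add_comm]
  simp only [Finset.card_filter, Fintype.sum_prod_type, List.countP_flatMap, Function.comp_def,
    h, sum_map_letters]

theorem mem_letters (k : Fin 4) : (k : ℕ) ∈ letters := by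
  revert k
  decide

theorem mem_others : ∀ {a b : Fin 4}, b ≠ a → (b : ℕ) ∈ others a := by
  decide

theorem Realizes.walkCount_eq {F : Fin 4 → A} {P : Pattern} (h : Realizes F P)
    (hP : tableCheck P = true) {c a b : Fin 4} (hc : c ≠ a) (hb : b ≠ a) :
    walkCount F (c, a, b) = P.entry c a b := by
  classical
  simp only [tableCheck, Bool.and_eq_true, List.all_eq_true, Nat.ble_eq, Nat.beq_eq] at hP
  rw [hP.2 a (mem_letters a) c (mem_others hc) b (mem_others hb), Pattern.ends,
    ← card_filter_eq_countP (fun d e f => (P.s d + P.s f + (P.n - P.s e)) % P.n), walkCount]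
  congr! 2 with u
  rw [h.endPos_eq_iff (fun k => hP.1 k (mem_letters k)), Nat.beq_eq]

theorem Realizes.profile_eq {F : Fin 4 → A} {P : Pattern} (h : Realizes F P)
    (hP : tableCheck P = true) : profile F = P.prof := by
  have : profile F = ∑ t : Fin 4 × Fin 4 × Fin 4 with t.1 ≠ t.2.1 ∧ t.2.2 ≠ t.2.1,
      2 ^ (6 * P.entry t.1 t.2.1 t.2.2) := by
    refine Finset.sum_congr rfl fun t ht => ?_
    obtain ⟨h₁, h₂⟩ := (Finset.mem_filter.1 ht).2
    rw [← h.walkCount_eq hP h₁ h₂]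
  simp only [this, Finset.sum_filter, Fintype.sum_prod_type, Pattern.prof, sum_map_letters,
    sum_map_others, ite_and]
  rw [Finset.sum_comm]
  refine Finset.sum_congr rfl fun a _ => Finset.sum_congr rfl fun c _ => ?_
  split_ifs
  · rfl
  · exact Finset.sum_const_zero

end Flags

section Rigidity

variable {A : Type*} [AddCommGroup A] {F G : Fin 4 → A} (I : FlagIso F G) {P Q : Pattern}

namespace FlagIso

theorem edge_eq_true (hF : F.Injective) (hP : Realizes F P) (hQ : Realizes G Q)
    (hPt : tableCheck P = true) (hQt : tableCheck Q = true) {i x : A} {a : Fin 4}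
    (hx : i + F a = x) {p q : ℕ} (hp : decode p = I.ρ i) (hq : decode q = I.κ x) :
    edge P Q a p q = true := by
  have hdp (k : Fin 4) : dig p k = I.ρ i k := congrArg Fin.val (congrFun hp k)
  have hdq (k : Fin 4) : dig q k = I.κ x k := congrArg Fin.val (congrFun hq k)
  have hval : ∀ a : Fin 4, ∀ m ∈ others a, ∃ k : Fin 4, k = m ∧ k ≠ a := by decide
  simp only [edge, Bool.and_eq_true, List.all_eq_true, Nat.beq_eq, hdp, hdq]
  have hκ := I.κ_add i a
  rw [hx] at hκ
  refine ⟨by rw [hκ], fun m hm m' hm' => ?_⟩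
  obtain ⟨c, rfl, hc⟩ := hval a m hm
  obtain ⟨b, rfl, hb⟩ := hval a m' hm'
  rw [hdp, hdq, ← hP.walkCount_eq hPt hc hb, I.walkCount_eq hF i, hx]
  refine hQ.walkCount_eq hQt ((I.ρ_injective hF i).ne hc) ?_
  rw [← hκ]
  exact (I.κ_injective hF x).ne hb

theorem exists_code_ρ (hF : F.Injective) (i : A) : ∃ p ∈ permCodes, decode p = I.ρ i :=
  mem_permCodes_of_injective _ (I.ρ_injective hF i)

theorem exists_code_κ (hF : F.Injective) (x : A) : ∃ p ∈ permCodes, decode p = I.κ x :=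
  mem_permCodes_of_injective _ (I.κ_injective hF x)

theorem hexagonCheck_eq_false (hF : F.Injective) (hP : Realizes F P) (hQ : Realizes G Q)
    (hPt : tableCheck P = true) (hQt : tableCheck Q = true) {i x : A} {a : Fin 4}
    (hx : i + F a = x) {p q : ℕ} (hp : decode p = I.ρ i) (hq : decode q = I.κ x) (b c : Fin 4) :
    hexagonCheck P Q a p q b c = false := by
  obtain ⟨r₂, h₂, hr₂⟩ := I.exists_code_ρ hF (x - F b)
  obtain ⟨r₃, h₃, hr₃⟩ := I.exists_code_κ hF (x - F b + F c)
  obtain ⟨r₄, h₄, hr₄⟩ := I.exists_code_ρ hF (x - F b + F c - F a)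
  obtain ⟨r₅, h₅, hr₅⟩ := I.exists_code_κ hF (i + F c)
  by_contra h
  simp only [Bool.not_eq_false, hexagonCheck, Bool.or_eq_true, Bool.not_eq_true',
    List.all_eq_true] at h
  have e {j y : A} {k : Fin 4} (hy : j + F k = y) {p q : ℕ} (hp : decode p = I.ρ j)
      (hq : decode q = I.κ y) : ¬ edge P Q k p q = false := by
    rw [I.edge_eq_true hF hP hQ hPt hQt hy hp hq]
    decide
  have h₆ := ((h r₂ h₂).resolve_left (e (sub_add_cancel _ _) hr₂ hq) r₃ h₃).resolve_left
    (e rfl hr₂ hr₃)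
  have h₇ := ((h₆ r₄ h₄).resolve_left (e (sub_add_cancel _ _) hr₄ hr₃) r₅ h₅)
  have hxy : x - F b + F c - F a + F b = i + F c := by
    rw [← hx]
    abel
  have h₈ := h₇.resolve_left fun h => h.elim (e hxy hr₄ hr₅) (e rfl hp hr₅)
  have hd {r : ℕ} {f : Fin 4 → Fin 4} (hr : decode r = f) (k : Fin 4) : dig r k = f k :=
    congrArg Fin.val (congrFun hr k)
  rw [hd hq, hd hq, hd hr₂, hd hr₃, hd hr₄, hd hr₅, ← Bool.not_eq_true, ← hQ.1] at h₈
  refine h₈ ?_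
  have k₁ := I.σ_add i a
  have k₂ := I.τ_sub x b
  have k₃ := I.σ_add (x - F b) c
  have k₄ := I.τ_sub (x - F b + F c) a
  have k₅ := I.σ_add (x - F b + F c - F a) b
  have k₆ := I.τ_sub (i + F c) c
  rw [hx, ← I.κ_add, hx] at k₁
  rw [hxy] at k₅
  rw [add_sub_cancel_right] at k₆
  linear_combination (norm := module) -(k₁ + k₂ + k₃ + k₄ + k₅ + k₆)

theorem ρ_eq_κ (hF : F.Injective) (hP : Realizes F P) (hQ : Realizes G Q)
    (hPt : tableCheck P = true) (hQt : tableCheck Q = true) (h : rigidCheck P Q = true)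
    (i : A) (a : Fin 4) : I.ρ i = I.κ (i + F a) := by
  obtain ⟨p, hp, hpi⟩ := I.exists_code_ρ hF i
  obtain ⟨q, hq, hqi⟩ := I.exists_code_κ hF (i + F a)
  simp only [rigidCheck, fiber, List.all_eq_true, List.mem_filter, Nat.beq_eq, and_imp,
    Bool.or_eq_true, Bool.not_eq_true', List.any_eq_true, Bool.and_eq_true] at h
  have hval : ∀ a : Fin 4, ∀ m ∈ others a, ∃ k : Fin 4, k = m := by decide
  have hpq : dig q a = dig p a := by
    have h₁ := congrArg Fin.val (congrFun hpi a)
    have h₂ := congrArg Fin.val (congrFun hqi a)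
    rw [I.κ_add] at h₂
    exact h₂.trans h₁.symm
  obtain (rfl | h₁) | ⟨b, hb, c, hc, -, h₁⟩ :=
    h a (mem_letters a) (dig p a) (mem_letters (decode p a)) p hp rfl q hq hpq
  · rw [← hpi, ← hqi]
  · rw [I.edge_eq_true hF hP hQ hPt hQt rfl hpi hqi] at h₁
    exact absurd h₁ (by decide)
  · obtain ⟨b, rfl⟩ := hval a b hb
    obtain ⟨c, rfl⟩ := hval a c hc
    rw [I.hexagonCheck_eq_false hF hP hQ hPt hQt rfl hpi hqi] at h₁
    exact absurd h₁ (by decide)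

/-- If all the maps on lines and points agree, then the isomorphism is affine near `0`. -/
theorem map_evalVec (h : ∀ i a, I.ρ i = I.κ (i + F a)) (w : Vec) :
    I.ρ (evalVec F w) = I.ρ 0 ∧
      I.τ (evalVec F w) = I.τ 0 + evalVec (G ∘ I.ρ 0) w := by
  have step (x : A) (k l : Fin 4) : I.ρ (x + F k - F l) = I.ρ x ∧
      I.τ (x + F k - F l) = I.τ x + (G (I.ρ x k) - G (I.ρ x l)) := by
    refine ⟨?_, ?_⟩
    · rw [h _ l, sub_add_cancel, ← h]
    · rw [I.τ_sub, I.σ_add, ← h]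
      abel
  let S : AddSubgroup Vec :=
    { carrier := {w | ∀ x, I.ρ (x + evalVec F w) = I.ρ x ∧
        I.τ (x + evalVec F w) = I.τ x + evalVec (G ∘ I.ρ x) w}
      zero_mem' := fun x => by simp
      add_mem' := fun {w w'} hw hw' x => by
        rw [map_add, ← add_assoc, map_add, (hw' _).1, (hw' _).2, (hw x).1, (hw x).2, add_assoc]
        exact ⟨rfl, rfl⟩
      neg_mem' := fun {w} hw x => by
        have := hw (x + evalVec F (-w))
        rw [add_assoc, ← map_add, neg_add_cancel, map_zero, add_zero] at this
        rw [this.1, this.2, map_neg, map_neg]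
        simp }
  have hS (k : Fin 4) : (unitVec k : Vec) ∈ S := by
    intro x
    rw [evalVec_unitVec, evalVec_unitVec, ← add_sub_assoc]
    exact step x k 0
  have hw : w = w.1 • unitVec 1 + w.2.1 • unitVec 2 + w.2.2 • unitVec 3 := by
    ext <;> simp [unitVec]
  have hwS : w ∈ S := by
    rw [hw]
    exact add_mem (add_mem (S.zsmul_mem (hS 1) _) (S.zsmul_mem (hS 2) _)) (S.zsmul_mem (hS 3) _)
  simpa using hwS 0

theorem evalVec_eq_zero_iff (h : ∀ i a, I.ρ i = I.κ (i + F a)) (w : Vec) :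
    evalVec F w = 0 ↔ evalVec (G ∘ I.ρ 0) w = 0 := by
  rw [← I.τ_injective.eq_iff, (I.map_evalVec h w).2, add_eq_left]

end FlagIso

end Rigidity

section Affine

theorem exists_unit_mul_eq_of_addOrderOf_eq {v : ℕ} [NeZero v] {d D : ZMod v}
    (h : addOrderOf d = addOrderOf D) : ∃ u : (ZMod v)ˣ, D = u * d := by
  have key (a : ZMod v) : ∃ u : (ZMod v)ˣ, a = u * ((v / addOrderOf a : ℕ) : ZMod v) := by
    obtain ⟨m, hm, u, hu, ha⟩ := ZMod.eq_unit_mul_divisor a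
    have hv := NeZero.ne v
    have hm₀ : m ≠ 0 := fun h => hv (Nat.eq_zero_of_zero_dvd (h ▸ hm))
    have ho : addOrderOf a = v / m := by
      rw [ha, ← smul_eq_mul, ← hu.unit_spec, ← Units.smul_def]
      rw [show hu.unit • (m : ZMod v) = DistribMulAction.toAddEquiv (ZMod v) hu.unit m from rfl,
        AddEquiv.addOrderOf_eq, ZMod.addOrderOf_coe m hv, Nat.gcd_eq_right hm]
    refine ⟨hu.unit, ?_⟩
    rw [ho, Nat.div_div_self hm hv]
    exact ha
  obtain ⟨u, hu⟩ := key d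
  obtain ⟨w, hw⟩ := key D
  refine ⟨w * u⁻¹, ?_⟩
  rw [hw, ← h, Units.val_mul, mul_assoc]
  conv_rhs => rw [hu, Units.inv_mul_cancel_left]

/-- `G` is the image of `F` under an affine map with invertible linear part. -/
def AffineEquivalent {v : ℕ} (F G : Fin 4 → ZMod v) : Prop :=
  ∃ u : (ZMod v)ˣ, ∀ k, G k - G 0 = u * (F k - F 0)

theorem affineEquivalent_of_evalVec {v : ℕ} [NeZero v] {F G : Fin 4 → ZMod v}
    (h : ∀ w, evalVec F w = 0 ↔ evalVec G w = 0) : AffineEquivalent F G := by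
  obtain ⟨⟨_, w₀, rfl⟩, hd⟩ := IsAddCyclic.exists_generator (α := (evalVec F).range)
  have hw (w : Vec) : ∃ m : ℤ, evalVec F w = m • evalVec F w₀ ∧ evalVec G w = m • evalVec G w₀ := by
    obtain ⟨m, hm⟩ := hd ⟨_, w, rfl⟩
    have hm : m • evalVec F w₀ = evalVec F w := congrArg Subtype.val hm
    refine ⟨m, hm.symm, ?_⟩
    rw [← map_zsmul, ← sub_eq_zero, ← map_sub, ← h, map_sub, map_zsmul, hm, sub_self]
  obtain ⟨u, hu⟩ : ∃ u : (ZMod v)ˣ, evalVec G w₀ = u * evalVec F w₀ := by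
    refine exists_unit_mul_eq_of_addOrderOf_eq (Nat.dvd_right_iff_eq.1 fun n => ?_)
    rw [addOrderOf_dvd_iff_nsmul_eq_zero, addOrderOf_dvd_iff_nsmul_eq_zero, ← map_nsmul,
      ← map_nsmul, h]
  refine ⟨u, fun k => ?_⟩
  rw [← evalVec_unitVec, ← evalVec_unitVec]
  obtain ⟨m, h₁, h₂⟩ := hw (unitVec k)
  rw [h₁, h₂, hu, mul_smul_comm]

theorem Realizes.affineEquivalent {v : ℕ} [NeZero v] {F G : Fin 4 → ZMod v} {P Q : Pattern}
    (hP : Realizes F P) (hQ : Realizes G Q) (hPf : P.full = true) (hQf : Q.full = true)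
    (hn : P.n = Q.n) (hs : ∀ k : Fin 4, P.s k = Q.s k) : AffineEquivalent F G := by
  obtain ⟨t, ht, hF⟩ := hP.2 hPf
  obtain ⟨t', ht', hG⟩ := hQ.2 hQf
  obtain ⟨u, rfl⟩ := exists_unit_mul_eq_of_addOrderOf_eq (ht.trans (hn.trans ht'.symm))
  refine ⟨u, fun k => ?_⟩
  rw [hF k, hG k, hs, add_sub_cancel_left, add_sub_cancel_left, mul_smul_comm]

theorem s_eq_of_full : ∀ P ∈ patterns, ∀ Q ∈ patterns, P.full = true → Q.full = true →
    P.s2 = Q.s2 → P.s3 = Q.s3 → ∀ k : Fin 4, P.s k = Q.s k := by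
  have h : ∀ P ∈ patterns, P.full = true → P.s1 = 1 := by decide +kernel
  intro P hP Q hQ hPf hQf h₂ h₃ k
  fin_cases k
  exacts [rfl, (h P hP hPf).trans (h Q hQ hQf).symm, h₂, h₃]

theorem FlagIso.exists_affineEquivalent {v : ℕ} [NeZero v] {F G : Fin 4 → ZMod v}
    (I : FlagIso F G) (hF : F.Injective) {P Q : Pattern} (hPm : P ∈ patterns)
    (hQm : Q ∈ patterns) (hP : Realizes F P) (hQ : Realizes G Q) :
    ∃ π : Fin 4 → Fin 4, π.Injective ∧ AffineEquivalent F (G ∘ π) := by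
  have hPt := List.all_eq_true.1 tableCheck_patterns P hPm
  have hQt := List.all_eq_true.1 tableCheck_patterns Q hQm
  have h := List.all_eq_true.1 (List.all_eq_true.1 pairCheck_patterns P hPm) Q hQm
  simp only [pairCheck, Bool.or_eq_true, Bool.and_eq_true, Bool.not_eq_true', beq_iff_eq] at h
  obtain (h | ⟨⟨⟨⟨hPf, hQf⟩, hn⟩, h₂⟩, h₃⟩) | h := h
  · rw [← hP.profile_eq hPt, I.profile_eq hF, hQ.profile_eq hQt, Nat.beq_refl] at h
    exact absurd h (by decide)
  · exact ⟨id, Function.injective_id,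
      hP.affineEquivalent hQ hPf hQf hn (s_eq_of_full P hPm Q hQm hPf hQf h₂ h₃)⟩
  · exact ⟨I.ρ 0, I.ρ_injective hF 0, affineEquivalent_of_evalVec
      (I.evalVec_eq_zero_iff (I.ρ_eq_κ hF hP hQ hPt hQt h))⟩

end Affine

section Configurations

variable {v : ℕ}

theorem sidon_of_card [NeZero v] {F : Fin 4 → ZMod v}
    (h : (Finset.univ.image F - Finset.univ.image F).card = 13) : Sidon F := by
  let D : Finset (Fin 4 × Fin 4) := {p | p.1 ≠ p.2}
  have hD : D.card = 12 := by decide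
  have hsub : Finset.univ.image F - Finset.univ.image F =
      insert 0 (D.image fun p => F p.1 - F p.2) := by
    ext x
    simp only [Finset.mem_sub, Finset.mem_image, Finset.mem_univ, true_and, Finset.mem_insert, D,
      Finset.mem_filter, Prod.exists]
    constructor
    · rintro ⟨_, ⟨a, rfl⟩, _, ⟨b, rfl⟩, rfl⟩
      by_cases hab : a = b
      · exact Or.inl (by rw [hab, sub_self])
      · exact Or.inr ⟨a, b, hab, rfl⟩
    · rintro (rfl | ⟨a, b, -, rfl⟩)
      · exact ⟨F 0, ⟨0, rfl⟩, F 0, ⟨0, rfl⟩, sub_self _⟩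
      · exact ⟨F a, ⟨a, rfl⟩, F b, ⟨b, rfl⟩, rfl⟩
  rw [hsub] at h
  have himage : (D.image fun p => F p.1 - F p.2).card ≤ 12 := hD ▸ Finset.card_image_le
  have h₀ : (0 : ZMod v) ∉ D.image fun p => F p.1 - F p.2 := fun h₀ => by
    rw [Finset.insert_eq_of_mem h₀] at h
    omega
  rw [Finset.card_insert_of_notMem h₀] at h
  have hinj : Set.InjOn (fun p : Fin 4 × Fin 4 => F p.1 - F p.2) D :=
    Finset.card_image_iff.1 (by rw [hD]; omega)
  intro a b c d hab
  by_contra! hne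
  have h₁ : F a - F b = F d - F c := by linear_combination hab
  by_cases hdc : d = c
  · refine h₀ (Finset.mem_image.2 ⟨(a, b), by simpa [D] using hne.1, ?_⟩)
    simpa [hdc] using h₁
  · exact hne.2 (congrArg Prod.fst
      (hinj (x₁ := (a, b)) (x₂ := (d, c)) (by simpa [D] using hne.1) (by simpa [D] using hdc) h₁))

theorem exists_realizes [NeZero v] {S : Finset (ZMod v)} (hcard : S.card = 4)
    (hdiff : (S - S).card = 13) :
    ∃ F : Fin 4 → ZMod v, Finset.univ.image F = S ∧ Sidon F ∧ ∃ P ∈ patterns, Realizes F P := by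
  let e := (S.equivFinOfCardEq hcard).symm
  let F : Fin 4 → ZMod v := fun k => e k
  have hS : Finset.univ.image F = S := by
    ext x
    simp only [Finset.mem_image, Finset.mem_univ, true_and]
    exact ⟨fun ⟨k, hk⟩ => hk ▸ (e k).2, fun hx => ⟨e.symm ⟨x, hx⟩, by simp [F]⟩⟩
  have hF : Sidon F := sidon_of_card (by rwa [hS])
  obtain ⟨π, hπ, P, hP, h⟩ := hF.classified
  refine ⟨F ∘ π, ?_, hF.comp hπ, P, hP, h⟩
  rw [← Finset.image_image, Finset.image_univ_of_surjective (Finite.surjective_of_injective hπ), hS]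

theorem mem_line {F : Fin 4 → ZMod v} {i x : ZMod v} :
    x ∈ (Finset.univ.image F).image (· + i) ↔ ∃ k, i + F k = x := by
  simp only [Finset.mem_image, Finset.mem_univ, true_and, exists_exists_eq_and, add_comm]

theorem Sidon.line_injective {F : Fin 4 → ZMod v} (hF : Sidon F) :
    Function.Injective fun i => (Finset.univ.image F).image (· + i) := by
  intro i j hij
  have hmem (k : Fin 4) : ∃ l, j + F l = i + F k :=
    mem_line.1 ((Finset.ext_iff.1 hij _).1 (mem_line.2 ⟨k, rfl⟩))
  obtain ⟨a, ha⟩ := hmem 0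
  obtain ⟨b, hb⟩ := hmem 1
  have h : F a + F 1 = F b + F 0 := by linear_combination ha - hb
  obtain rfl | rfl := hF a b 1 0 h
  · exact absurd (hF.injective (add_left_cancel h)) (by decide)
  · exact (add_right_cancel ha).symm

theorem exists_flagIso {F G : Fin 4 → ZMod v} (hF : Sidon F)
    (h : ConfIso v (Finset.univ.image F) (Finset.univ.image G)) : Nonempty (FlagIso F G) := by
  obtain ⟨σ, hσ⟩ := h
  have hline (i : ZMod v) : ∃ j, ((Finset.univ.image F).image (· + i)).image σ =
      (Finset.univ.image G).image (· + j) :=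
    hσ.subset (Set.mem_image_of_mem _ ⟨i, rfl⟩)
  choose τ hτ using hline
  have hpoint (i : ZMod v) (k : Fin 4) : ∃ l, τ i + G l = σ (i + F k) :=
    mem_line.1 (hτ i ▸ Finset.mem_image_of_mem σ (mem_line.2 ⟨k, rfl⟩))
  choose ρ hρ using hpoint
  refine ⟨⟨σ, τ, fun i j hij => hF.line_injective ?_, σ.injective, ρ, fun i k => (hρ i k).symm⟩⟩
  refine Finset.image_injective σ.injective ?_
  simp only [hτ, hij]

theorem AffineEquivalent.multEquiv {F G : Fin 4 → ZMod v} (h : AffineEquivalent F G) :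
    MultEquiv v (Finset.univ.image F) (Finset.univ.image G) := by
  obtain ⟨u, hu⟩ := h
  refine ⟨u⁻¹, F 0 - (u⁻¹ : (ZMod v)ˣ) * G 0, ?_⟩
  rw [Finset.image_image]
  congr 1
  ext1 k
  have := congrArg (((u⁻¹ : (ZMod v)ˣ) : ZMod v) * ·) (hu k)
  simp only [Units.inv_mul_cancel_left] at this
  simp only [Function.comp_apply]
  linear_combination -this

theorem ConfIso.of_multEquiv {S₁ S₂ : Finset (ZMod v)} (h : MultEquiv v S₁ S₂) :
    ConfIso v S₁ S₂ := by
  obtain ⟨a, b, rfl⟩ := h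
  have hline (i : ZMod v) : ((S₂.image fun x => (a : ZMod v) * x + b).image (· + i)).image
      ((Equiv.subRight b).trans a⁻¹.mulLeft) =
        S₂.image (· + (a⁻¹ : (ZMod v)ˣ) * i) := by
    rw [Finset.image_image, Finset.image_image]
    congr 1
    ext1 x
    simp only [Function.comp_apply, Equiv.trans_apply, Equiv.subRight_apply, Units.mulLeft_apply]
    rw [show (a : ZMod v) * x + b + i - b = a * x + i by ring, mul_add, Units.inv_mul_cancel_left]
  refine ⟨(Equiv.subRight b).trans a⁻¹.mulLeft, Set.ext fun B => ⟨?_, ?_⟩⟩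
  · rintro ⟨_, ⟨i, rfl⟩, rfl⟩
    exact ⟨_, hline i⟩
  · rintro ⟨i, rfl⟩
    refine ⟨_, ⟨a * i, rfl⟩, (hline _).trans ?_⟩
    rw [Units.inv_mul_cancel_left]

theorem MultEquiv.of_confIso [NeZero v] {S₁ S₂ : Finset (ZMod v)}
    (hcard₁ : S₁.card = 4) (hdiff₁ : (S₁ - S₁).card = 13)
    (hcard₂ : S₂.card = 4) (hdiff₂ : (S₂ - S₂).card = 13) (h : ConfIso v S₁ S₂) :
    MultEquiv v S₁ S₂ := by
  obtain ⟨F, rfl, hF, P, hP, hFP⟩ := exists_realizes hcard₁ hdiff₁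
  obtain ⟨G, rfl, -, Q, hQ, hGQ⟩ := exists_realizes hcard₂ hdiff₂
  obtain ⟨I⟩ := exists_flagIso hF h
  obtain ⟨π, hπ, h⟩ := I.exists_affineEquivalent hF.injective hP hQ hFP hGQ
  have := h.multEquiv
  rwa [← Finset.image_image,
    Finset.image_univ_of_surjective (Finite.surjective_of_injective hπ)] at this

end Configurations

end CyclicConf

/-- two cyclic configurations of type (v₄) are isomorphic iff they are
multiplier equivalent. -/
theorem confIso_iff_multEquiv_type_v4
    (v : ℕ) (hv : 13 ≤ v)
    (S₁ S₂ : Finset (ZMod v))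
    (hcard₁ : S₁.card = 4) (hdiff₁ : (S₁ - S₁).card = 13)
    (hcard₂ : S₂.card = 4) (hdiff₂ : (S₂ - S₂).card = 13) :
    ConfIso v S₁ S₂ ↔ MultEquiv v S₁ S₂ := by
  have : NeZero v := ⟨by omega⟩
  exact ⟨CyclicConf.MultEquiv.of_confIso hcard₁ hdiff₁ hcard₂ hdiff₂,
    CyclicConf.ConfIso.of_multEquiv⟩
end

section
/- Let v > 4 be an even integer. Then the number of sets X ∈ B_con(v,3) with 0 ∈ X equals φ(v)(Φ(v) − 6)/2 − 3φ(v/2), where φ is Euler's totient function and Φ(v) = v·∏_{p | v, p prime} (1 + 1/p). -/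
open scoped Pointwise

/-- `B_con(v,3)`: base lines of connected cyclic configurations of type (v₃). -/
def Bcon3 (v : ℕ) : Set (Finset (ZMod v)) :=
  {X | X.card = 3 ∧ (X - X).card = 7 ∧
    AddSubgroup.closure ((X - X : Finset (ZMod v)) : Set (ZMod v)) = ⊤}

open Finset in
/-- Counting residues by a property of their least nonnegative representative. -/
lemma ZMod.card_filter_val (v : ℕ) [NeZero v] (p : ℕ → Prop) [DecidablePred p] :
    #{a : ZMod v | p a.val} = #{a ∈ range v | p a} := by
  refine card_bij (fun a _ => a.val) ?_ ?_ ?_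
  · intro a ha
    simpa [ZMod.val_lt] using ha
  · intro a _ b _ h
    exact ZMod.val_injective v h
  · intro b hb
    simp only [mem_filter, mem_range] at hb
    exact ⟨b, by simpa [ZMod.val_natCast_of_lt hb.1] using hb.2, ZMod.val_natCast_of_lt hb.1⟩

open Finset in
lemma ZMod.card_filter_dvd_val (v d : ℕ) [NeZero v] (hd : d ∣ v) :
    #{a : ZMod v | d ∣ a.val} = v / d := by
  obtain ⟨k, rfl⟩ := hd
  have hdk : d * k ≠ 0 := NeZero.ne _
  have hd : 0 < d := Nat.pos_of_ne_zero (left_ne_zero_of_mul hdk)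
  rw [ZMod.card_filter_val, Nat.mul_div_cancel_left _ hd]
  have : ({a ∈ range (d * k) | d ∣ a}) = (range k).image (d * ·) := by
    ext a
    simp only [mem_filter, mem_range, mem_image]
    constructor
    · rintro ⟨h, c, rfl⟩
      exact ⟨c, Nat.lt_of_mul_lt_mul_left h, rfl⟩
    · rintro ⟨c, h, rfl⟩
      exact ⟨Nat.mul_lt_mul_of_pos_left h hd, dvd_mul_right _ _⟩
  rw [this, card_image_of_injective _ (fun a b h => Nat.eq_of_mul_eq_mul_left hd h), card_range]

lemma ZMod.isCoprime_iff (v : ℕ) [NeZero v] (a b : ZMod v) :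
    IsCoprime a b ↔ ∀ p ∈ v.primeFactors, ¬ (p ∣ a.val ∧ p ∣ b.val) := by
  constructor
  · rintro ⟨m, n, h⟩ p hp ⟨ha, hb⟩
    have hpp := Nat.prime_of_mem_primeFactors hp
    have : Fact p.Prime := ⟨hpp⟩
    have h2 := congrArg (ZMod.castHom (Nat.dvd_of_mem_primeFactors hp) (ZMod p)) h
    have key : ∀ c : ZMod v, p ∣ c.val →
        ZMod.castHom (Nat.dvd_of_mem_primeFactors hp) (ZMod p) c = 0 := by
      intro c hc
      rw [← ZMod.natCast_zmod_val c, map_natCast, ZMod.natCast_eq_zero_iff]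
      exact hc
    rw [map_add, map_mul, map_mul, key a ha, key b hb, map_one] at h2
    simp at h2
  · intro h
    have hg : Nat.gcd (Nat.gcd a.val b.val) v = 1 := by
      by_contra hne
      obtain ⟨p, hp, hpd⟩ := Nat.exists_prime_and_dvd hne
      have h1 := hpd.trans (Nat.gcd_dvd_left _ _)
      exact h p (Nat.mem_primeFactors.2 ⟨hp, hpd.trans (Nat.gcd_dvd_right _ _), NeZero.ne v⟩)
        ⟨h1.trans (Nat.gcd_dvd_left _ _), h1.trans (Nat.gcd_dvd_right _ _)⟩
    have e1 := Nat.gcd_eq_gcd_ab (Nat.gcd a.val b.val) v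
    rw [hg, Nat.gcd_eq_gcd_ab a.val b.val] at e1
    have e2 := congrArg (Int.cast : ℤ → ZMod v) e1
    push_cast at e2
    simp only [ZMod.natCast_zmod_val, ZMod.natCast_self, zero_mul, add_zero] at e2
    refine ⟨(Nat.gcdA a.val b.val : ZMod v) * Nat.gcdA (Nat.gcd a.val b.val) v,
      (Nat.gcdB a.val b.val : ZMod v) * Nat.gcdA (Nat.gcd a.val b.val) v, ?_⟩
    linear_combination -e2

open Finset Classical in
/-- The number of coprime pairs in `ZMod v` (Jordan's totient `J₂`). -/
lemma ZMod.card_isCoprime (v : ℕ) [NeZero v] :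
    (#{x : ZMod v × ZMod v | IsCoprime x.1 x.2} : ℚ) =
      v ^ 2 * ∏ p ∈ v.primeFactors, (1 - 1 / (p : ℚ) ^ 2) := by
  have ind : ∀ x : ZMod v × ZMod v, (if IsCoprime x.1 x.2 then (1 : ℚ) else 0) =
      ∏ p ∈ v.primeFactors, (1 - if p ∣ x.1.val ∧ p ∣ x.2.val then (1 : ℚ) else 0) := by
    intro x
    split_ifs with h
    · rw [ZMod.isCoprime_iff] at h
      rw [prod_eq_one]
      intro p hp
      simp [h p hp]
    · rw [ZMod.isCoprime_iff] at h
      push Not at h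
      obtain ⟨p, hp, h⟩ := h
      rw [prod_eq_zero hp]
      simp [h]
  rw [card_filter]
  push_cast
  rw [sum_congr rfl (fun x _ => ind x)]
  simp only [sub_eq_add_neg, prod_one_add]
  rw [sum_comm, mul_sum]
  refine sum_congr rfl fun S hS => ?_
  rw [mem_powerset] at hS
  simp only [prod_neg]
  rw [← mul_sum]
  have hdvd : ∏ p ∈ S, p ∣ v :=
    prod_primes_dvd v (fun p hp => (Nat.prime_of_mem_primeFactors (hS hp)).prime)
      (fun p hp => Nat.dvd_of_mem_primeFactors (hS hp))
  have hS' : ∀ a : ℕ, (∀ p ∈ S, p ∣ a) ↔ ∏ p ∈ S, p ∣ a := fun a =>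
    ⟨fun h => prod_primes_dvd a (fun p hp => (Nat.prime_of_mem_primeFactors (hS hp)).prime) h,
      fun h p hp => (dvd_prod_of_mem (fun p => p) hp).trans h⟩
  have hsum : ∑ x : ZMod v × ZMod v, ∏ p ∈ S,
      (if p ∣ x.1.val ∧ p ∣ x.2.val then (1 : ℚ) else 0) = ((v / ∏ p ∈ S, p : ℕ) : ℚ) ^ 2 := by
    have : ∀ x : ZMod v × ZMod v, ∏ p ∈ S,
        (if p ∣ x.1.val ∧ p ∣ x.2.val then (1 : ℚ) else 0) =
        (if ∏ p ∈ S, p ∣ x.1.val then (1 : ℚ) else 0) *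
          (if ∏ p ∈ S, p ∣ x.2.val then (1 : ℚ) else 0) := by
      intro x
      have hiff : (∀ p ∈ S, p ∣ x.1.val ∧ p ∣ x.2.val) ↔
          ∏ p ∈ S, p ∣ x.1.val ∧ ∏ p ∈ S, p ∣ x.2.val := by
        simp only [← hS', forall_and]
      simp only [prod_ite_zero, prod_const_one, hiff]
      by_cases h1 : ∏ p ∈ S, p ∣ x.1.val <;> by_cases h2 : ∏ p ∈ S, p ∣ x.2.val <;> simp [h1, h2]
    simp only [this]
    rw [← univ_product_univ, sum_product, ← sum_mul_sum univ univ
      (fun a : ZMod v => if ∏ p ∈ S, p ∣ a.val then (1 : ℚ) else 0)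
      (fun b : ZMod v => if ∏ p ∈ S, p ∣ b.val then (1 : ℚ) else 0), sum_boole, ZMod.card_filter_dvd_val v _ hdvd, sq]
  have hne : ((∏ p ∈ S, p : ℕ) : ℚ) ≠ 0 := by
    have : (∏ p ∈ S, p) ≠ 0 := fun h => NeZero.ne v (Nat.eq_zero_of_zero_dvd (h ▸ hdvd))
    exact_mod_cast this
  rw [hsum, Nat.cast_div hdvd hne, div_pow]
  simp only [one_div, prod_inv_distrib, prod_pow, Nat.cast_prod]
  ring

lemma Nat.sq_mul_prod_one_sub_eq_totient_mul (v : ℕ) :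
    (v : ℚ) ^ 2 * ∏ p ∈ v.primeFactors, (1 - 1 / (p : ℚ) ^ 2) =
      (Nat.totient v : ℚ) * ((v : ℚ) * ∏ p ∈ v.primeFactors, (1 + 1 / (p : ℚ))) := by
  rw [Nat.totient_eq_mul_prod_factors]
  have : ∏ p ∈ v.primeFactors, (1 - 1 / (p : ℚ) ^ 2) =
      (∏ p ∈ v.primeFactors, (1 - (p : ℚ)⁻¹)) * ∏ p ∈ v.primeFactors, (1 + 1 / (p : ℚ)) := by
    rw [← Finset.prod_mul_distrib]
    refine Finset.prod_congr rfl fun p _ => ?_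
    ring
  rw [this]
  ring

open Finset Classical in
lemma ZMod.card_isCoprime_mul_eq (v : ℕ) [NeZero v] (c : ZMod v) :
    #{x : ZMod v × ZMod v | IsCoprime x.1 x.2 ∧ x.1 = c * x.2} = v.totient := by
  have key : ∀ b : ZMod v, IsCoprime (c * b) b ↔ IsUnit b := fun b =>
    ⟨fun ⟨m, n, h⟩ => IsUnit.of_mul_eq_one (m * c + n) (by linear_combination h),
      fun h => by
      obtain ⟨d, hd⟩ := h.exists_left_inv
      exact ⟨0, d, by rw [zero_mul, zero_add, hd]⟩⟩
  rw [← ZMod.card_units_eq_totient, ← card_univ]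
  symm
  refine card_bij (fun u _ => (c * (u : ZMod v), (u : ZMod v))) ?_ ?_ ?_
  · intro u _
    simp [key]
  · intro u _ w _ h
    exact Units.ext (Prod.ext_iff.1 h).2
  · rintro ⟨a, b⟩ h
    simp only [mem_filter, mem_univ, true_and] at h
    obtain ⟨h, rfl⟩ := h
    obtain ⟨u, rfl⟩ := (key b).1 h
    exact ⟨u, mem_univ _, rfl⟩

open Finset Classical in
lemma ZMod.card_isCoprime_swap (v : ℕ) [NeZero v] (P : ZMod v → ZMod v → Prop) :
    #{x : ZMod v × ZMod v | IsCoprime x.1 x.2 ∧ P x.2 x.1} =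
      #{x : ZMod v × ZMod v | IsCoprime x.1 x.2 ∧ P x.1 x.2} := by
  refine card_equiv (Equiv.prodComm _ _) ?_
  rintro ⟨a, b⟩
  simp [isCoprime_comm]

open Finset Classical in
lemma ZMod.card_isCoprime_sub (v : ℕ) [NeZero v] (P : ZMod v → Prop) :
    #{x : ZMod v × ZMod v | IsCoprime x.1 x.2 ∧ P (x.1 - x.2)} =
      #{x : ZMod v × ZMod v | IsCoprime x.1 x.2 ∧ P x.1} := by
  refine card_equiv ⟨fun x => (x.1 - x.2, x.2), fun x => (x.1 + x.2, x.2), ?_, ?_⟩ ?_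
  · intro x; simp
  · intro x; simp
  · rintro ⟨a, b⟩
    simp only [mem_filter, mem_univ, true_and, Equiv.coe_fn_mk]
    refine and_congr_left fun _ => ⟨?_, ?_⟩
    · rintro ⟨m, n, h⟩
      exact ⟨m, n + m, by linear_combination h⟩
    · rintro ⟨m, n, h⟩
      exact ⟨m, n - m, by linear_combination h⟩

lemma ZMod.two_mul_eq_zero_iff (k : ℕ) (hk : 0 < k) (a : ZMod (k + k)) :
    2 * a = 0 ↔ a = 0 ∨ a = (k : ZMod (k + k)) := by
  have : NeZero (k + k) := ⟨by omega⟩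
  have hlt := ZMod.val_lt a
  obtain ⟨n, hn⟩ : ∃ n, n = a.val := ⟨_, rfl⟩
  rw [← hn] at hlt
  have ha : a = (n : ZMod (k + k)) := by rw [hn, ZMod.natCast_zmod_val]
  rw [ha]
  constructor
  · intro h
    have h' : ((2 * n : ℕ) : ZMod (k + k)) = 0 := by exact_mod_cast h
    rw [ZMod.natCast_eq_zero_iff] at h'
    obtain ⟨c, hc⟩ := h'
    have hc2 : c < 2 := by
      by_contra hcon
      have : (k + k) * 2 ≤ (k + k) * c := Nat.mul_le_mul_left _ (by omega)
      omega
    interval_cases c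
    · left
      have : n = 0 := by omega
      simp [this]
    · right
      congr 1
      omega
  · have hk0 : ((k + k : ℕ) : ZMod (k + k)) = 0 := ZMod.natCast_self _
    push_cast at hk0
    rintro (h | h) <;> rw [h]
    · simp
    · linear_combination hk0

lemma ZMod.isCoprime_half_iff (k : ℕ) (hk : 2 < k) (b : ZMod (k + k)) :
    IsCoprime (k : ZMod (k + k)) b ↔ Nat.Coprime k b.val := by
  have : NeZero (k + k) := ⟨by omega⟩
  rw [ZMod.isCoprime_iff, ZMod.val_natCast_of_lt (by omega : k < k + k)]
  constructor
  · intro h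
    refine Nat.coprime_of_dvd fun p hp hpk hpb => h p ?_ ⟨hpk, hpb⟩
    exact Nat.mem_primeFactors.2 ⟨hp, hpk.add hpk, by omega⟩
  · intro h p hp ⟨h1, h2⟩
    exact Nat.not_coprime_of_dvd_of_dvd (Nat.prime_of_mem_primeFactors hp).one_lt h1 h2 h

open Finset in
lemma Nat.card_filter_coprime_range_add_self (k : ℕ) :
    #{b ∈ range (k + k) | Nat.Coprime k b} = 2 * k.totient := by
  have h : range (k + k) = Ico 0 (0 + k) ∪ Ico k (k + k) := by
    ext x
    simp only [mem_range, mem_union, mem_Ico]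
    omega
  rw [h, filter_union, card_union_of_disjoint, Nat.filter_coprime_Ico_eq_totient,
    Nat.filter_coprime_Ico_eq_totient, two_mul]
  refine disjoint_filter_filter (disjoint_left.2 fun x => ?_)
  simp only [mem_Ico]
  omega

open Finset Classical in
lemma ZMod.card_isCoprime_two_mul (k : ℕ) [NeZero (k + k)] (hk : 2 < k) :
    #{x : ZMod (k + k) × ZMod (k + k) | IsCoprime x.1 x.2 ∧ 2 * x.1 = 0} =
      (k + k).totient + 2 * k.totient := by
  have hk0 : (k : ZMod (k + k)) ≠ 0 := by
    rw [Ne, ZMod.natCast_eq_zero_iff]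
    intro h
    have := Nat.le_of_dvd (by omega) h
    omega
  have h : ({x : ZMod (k + k) × ZMod (k + k) | IsCoprime x.1 x.2 ∧ 2 * x.1 = 0} : Finset _) =
      ({x | IsCoprime x.1 x.2 ∧ x.1 = 0 * x.2} : Finset (ZMod (k + k) × ZMod (k + k))) ∪
      ({x | IsCoprime x.1 x.2 ∧ x.1 = k} : Finset (ZMod (k + k) × ZMod (k + k))) := by
    ext x
    simp only [mem_filter, mem_univ, true_and, mem_union, zero_mul,
      ZMod.two_mul_eq_zero_iff k (by omega), and_or_left]
  rw [h, card_union_of_disjoint, ZMod.card_isCoprime_mul_eq]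
  · congr 1
    rw [← Nat.card_filter_coprime_range_add_self, ← ZMod.card_filter_val]
    refine card_bij (fun x _ => x.2) ?_ ?_ ?_
    · rintro ⟨a, b⟩ h
      simp only [mem_filter, mem_univ, true_and] at h ⊢
      obtain ⟨h, rfl⟩ := h
      exact (ZMod.isCoprime_half_iff k hk b).1 h
    · rintro ⟨a, b⟩ h ⟨a', b'⟩ h' he
      simp only [mem_filter, mem_univ, true_and] at h h' he
      rw [h.2, h'.2, he]
    · intro b hb
      simp only [mem_filter, mem_univ, true_and] at hb
      exact ⟨(k, b), by simpa using (ZMod.isCoprime_half_iff k hk b).2 hb, rfl⟩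
  · refine disjoint_left.2 fun x => ?_
    simp only [mem_filter, mem_univ, true_and, zero_mul]
    rintro ⟨-, h1⟩ ⟨-, h2⟩
    exact hk0 (h2 ▸ h1)

/-- The six coincidences among the differences of `{0, a, b}` all fail. -/
def DistinctDiffs {R : Type*} [CommRing R] (a b : R) : Prop :=
  2 * a ≠ 0 ∧ 2 * b ≠ 0 ∧ 2 * (a - b) ≠ 0 ∧ a ≠ -1 * b ∧ a ≠ 2 * b ∧ b ≠ 2 * a

open Finset in
lemma card_sub_eq_seven_iff {R : Type*} [CommRing R] [DecidableEq R] (a b : R) :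
    (({0, a, b} : Finset R) - ({0, a, b} : Finset R)).card = 7 ↔ DistinctDiffs a b := by
  have h : (({0, a, b} : Finset R) - ({0, a, b} : Finset R)) =
      ([0, a, b, -a, -b, a - b, b - a] : List R).toFinset := by
    ext x
    simp only [mem_sub, mem_insert, mem_singleton, List.mem_toFinset, List.mem_cons,
      List.not_mem_nil, or_false]
    constructor
    · rintro ⟨y, (rfl | rfl | rfl), z, (rfl | rfl | rfl), rfl⟩ <;> simp
    · rintro (rfl | rfl | rfl | rfl | rfl | rfl | rfl)
      · exact ⟨0, by simp, 0, by simp, by simp⟩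
      · exact ⟨x, by simp, 0, by simp, by simp⟩
      · exact ⟨x, by simp, 0, by simp, by simp⟩
      · exact ⟨0, by simp, a, by simp, by simp⟩
      · exact ⟨0, by simp, b, by simp, by simp⟩
      · exact ⟨a, by simp, b, by simp, by simp⟩
      · exact ⟨b, by simp, a, by simp, by simp⟩
  rw [h]
  have h7 : ([0, a, b, -a, -b, a - b, b - a] : List R).toFinset.card = 7 ↔
      ([0, a, b, -a, -b, a - b, b - a] : List R).Nodup := by
    exact Multiset.toFinset_card_eq_card_iff_nodup
      (m := (([0, a, b, -a, -b, a - b, b - a] : List R) : Multiset R))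
  rw [h7]
  simp only [DistinctDiffs, List.nodup_cons, List.mem_cons, List.not_mem_nil, or_false, not_or,
    not_false_eq_true, List.nodup_nil, and_true]
  constructor
  · rintro h
    refine ⟨?_, ?_, ?_, ?_, ?_, ?_⟩ <;> grind
  · rintro ⟨h1, h2, h3, h4, h5, h6⟩
    refine ⟨⟨?_, ?_, ?_, ?_, ?_, ?_⟩, ⟨?_, ?_, ?_, ?_, ?_⟩, ⟨?_, ?_, ?_, ?_⟩,
      ⟨?_, ?_, ?_⟩, ⟨?_, ?_⟩, ?_⟩ <;> grind

lemma ZMod.closure_sub_eq_top_iff (v : ℕ) (a b : ZMod v) :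
    AddSubgroup.closure ((({0, a, b} : Finset (ZMod v)) - ({0, a, b} : Finset (ZMod v)) : Finset (ZMod v)) :
      Set (ZMod v)) = ⊤ ↔ IsCoprime a b := by
  have hc : AddSubgroup.closure ((({0, a, b} : Finset (ZMod v)) - ({0, a, b} : Finset (ZMod v)) : Finset (ZMod v)) :
      Set (ZMod v)) = AddSubgroup.closure {a, b} := by
    apply le_antisymm
    · rw [AddSubgroup.closure_le]
      have hmem : ∀ y ∈ ({0, a, b} : Finset (ZMod v)), y ∈ AddSubgroup.closure {a, b} := by
        intro y hy
        simp only [Finset.mem_insert, Finset.mem_singleton] at hy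
        rcases hy with rfl | rfl | rfl
        · exact zero_mem _
        · exact AddSubgroup.subset_closure (by simp)
        · exact AddSubgroup.subset_closure (by simp)
      intro x hx
      obtain ⟨y, hy, z, hz, rfl⟩ := Finset.mem_sub.1 (Finset.mem_coe.1 hx)
      exact sub_mem (hmem y hy) (hmem z hz)
    · refine AddSubgroup.closure_mono ?_
      rintro x (rfl | rfl)
      · exact Finset.mem_coe.2 (Finset.mem_sub.2 ⟨x, by simp, 0, by simp, by simp⟩)
      · exact Finset.mem_coe.2 (Finset.mem_sub.2 ⟨x, by simp, 0, by simp, by simp⟩)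
  rw [hc]
  constructor
  · intro h
    have h1 : (1 : ZMod v) ∈ AddSubgroup.closure {a, b} := h ▸ AddSubgroup.mem_top _
    obtain ⟨m, n, h⟩ := AddSubgroup.mem_closure_pair.1 h1
    exact ⟨m, n, by simpa using h⟩
  · rintro ⟨m, n, h⟩
    refine (AddSubgroup.eq_top_iff' _).2 fun x => AddSubgroup.mem_closure_pair.2 ?_
    obtain ⟨m, rfl⟩ := ZMod.intCast_surjective m
    obtain ⟨n, rfl⟩ := ZMod.intCast_surjective n
    obtain ⟨x, rfl⟩ := ZMod.intCast_surjective x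
    refine ⟨x * m, x * n, ?_⟩
    simp only [zsmul_eq_mul]
    push_cast
    linear_combination (x : ZMod v) * h

/-- Among six pairwise exclusive propositions and the failure of all of them, exactly one holds. -/
lemma Nat.one_eq_sum_ite_of_exclusive {P1 P2 P3 P4 P5 P6 : Prop}
    [Decidable P1] [Decidable P2] [Decidable P3] [Decidable P4] [Decidable P5] [Decidable P6]
    [Decidable (¬ P1 ∧ ¬ P2 ∧ ¬ P3 ∧ ¬ P4 ∧ ¬ P5 ∧ ¬ P6)]
    (h1 : P1 → ¬ P2 ∧ ¬ P3 ∧ ¬ P4 ∧ ¬ P5 ∧ ¬ P6)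
    (h2 : P2 → ¬ P3 ∧ ¬ P4 ∧ ¬ P5 ∧ ¬ P6)
    (h3 : P3 → ¬ P4 ∧ ¬ P5 ∧ ¬ P6)
    (h4 : P4 → ¬ P5 ∧ ¬ P6)
    (h5 : P5 → ¬ P6) :
    1 = (if ¬ P1 ∧ ¬ P2 ∧ ¬ P3 ∧ ¬ P4 ∧ ¬ P5 ∧ ¬ P6 then 1 else 0) + (if P1 then 1 else 0) +
      (if P2 then 1 else 0) + (if P3 then 1 else 0) + (if P4 then 1 else 0) +
      (if P5 then 1 else 0) + (if P6 then 1 else 0) := by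
  by_cases P1 <;> by_cases P2 <;> by_cases P3 <;> by_cases P4 <;> by_cases P5 <;> by_cases P6 <;>
    simp_all

open Finset Classical in
/-- Coprime pairs are the pairs with distinct differences together with six disjoint
degenerate families. -/
lemma ZMod.card_isCoprime_eq_add (v : ℕ) [NeZero v] (hv : 4 < v) :
    #{x : ZMod v × ZMod v | IsCoprime x.1 x.2} =
      #{x : ZMod v × ZMod v | IsCoprime x.1 x.2 ∧ DistinctDiffs x.1 x.2} +
      #{x : ZMod v × ZMod v | IsCoprime x.1 x.2 ∧ 2 * x.1 = 0} +
      #{x : ZMod v × ZMod v | IsCoprime x.1 x.2 ∧ 2 * x.2 = 0} +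
      #{x : ZMod v × ZMod v | IsCoprime x.1 x.2 ∧ 2 * (x.1 - x.2) = 0} +
      #{x : ZMod v × ZMod v | IsCoprime x.1 x.2 ∧ x.1 = -1 * x.2} +
      #{x : ZMod v × ZMod v | IsCoprime x.1 x.2 ∧ x.1 = 2 * x.2} +
      #{x : ZMod v × ZMod v | IsCoprime x.1 x.2 ∧ x.2 = 2 * x.1} := by
  have h3 : (3 : ZMod v) ≠ 0 := by
    intro h
    have h' : ((3 : ℕ) : ZMod v) = 0 := by exact_mod_cast h
    rw [ZMod.natCast_eq_zero_iff] at h'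
    have := Nat.le_of_dvd (by omega) h'
    omega
  have h4 : (4 : ZMod v) ≠ 0 := by
    intro h
    have h' : ((4 : ℕ) : ZMod v) = 0 := by exact_mod_cast h
    rw [ZMod.natCast_eq_zero_iff] at h'
    have := Nat.le_of_dvd (by omega) h'
    omega
  simp only [card_filter, ← sum_add_distrib]
  refine sum_congr rfl ?_
  rintro ⟨a, b⟩ -
  by_cases hc : IsCoprime a b
  swap
  · simp [hc]
  have h3' : 3 * a = 0 → 3 * b = 0 → False := fun ha hb => by
    obtain ⟨m, n, h⟩ := hc
    exact h3 (by linear_combination (-3) * h + m * ha + n * hb)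
  have h4' : 4 * a = 0 → 4 * b = 0 → False := fun ha hb => by
    obtain ⟨m, n, h⟩ := hc
    exact h4 (by linear_combination (-4) * h + m * ha + n * hb)
  simp only [hc, true_and, DistinctDiffs, ne_eq]
  have e1 : 2 * a = 0 → ¬ (2 * b = 0) ∧ ¬ (2 * (a - b) = 0) ∧ ¬ (a = -1 * b) ∧ ¬ (a = 2 * b) ∧ ¬ (b = 2 * a) := by grind
  have e2 : 2 * b = 0 → ¬ (2 * (a - b) = 0) ∧ ¬ (a = -1 * b) ∧ ¬ (a = 2 * b) ∧ ¬ (b = 2 * a) := by grind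
  have e3 : 2 * (a - b) = 0 → ¬ (a = -1 * b) ∧ ¬ (a = 2 * b) ∧ ¬ (b = 2 * a) := by grind
  have e4 : a = -1 * b → ¬ (a = 2 * b) ∧ ¬ (b = 2 * a) := by grind
  have e5 : a = 2 * b → ¬ (b = 2 * a) := by grind
  rw [if_pos trivial]
  exact Nat.one_eq_sum_ite_of_exclusive e1 e2 e3 e4 e5

open Finset Classical in
lemma ZMod.card_isCoprime_even (k : ℕ) [NeZero (k + k)] (hk : 2 < k) :
    #{x : ZMod (k + k) × ZMod (k + k) | IsCoprime x.1 x.2} =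
      #{x : ZMod (k + k) × ZMod (k + k) | IsCoprime x.1 x.2 ∧ DistinctDiffs x.1 x.2} +
        6 * (k + k).totient + 6 * k.totient := by
  have h1 := ZMod.card_isCoprime_two_mul k hk
  have h2 : #{x : ZMod (k + k) × ZMod (k + k) | IsCoprime x.1 x.2 ∧ 2 * x.2 = 0} =
      #{x : ZMod (k + k) × ZMod (k + k) | IsCoprime x.1 x.2 ∧ 2 * x.1 = 0} := by
    convert ZMod.card_isCoprime_swap (k + k) (fun a _ => 2 * a = 0)
  have h3 : #{x : ZMod (k + k) × ZMod (k + k) | IsCoprime x.1 x.2 ∧ 2 * (x.1 - x.2) = 0} =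
      #{x : ZMod (k + k) × ZMod (k + k) | IsCoprime x.1 x.2 ∧ 2 * x.1 = 0} := by
    convert ZMod.card_isCoprime_sub (k + k) (fun a => 2 * a = 0)
  have h6 : #{x : ZMod (k + k) × ZMod (k + k) | IsCoprime x.1 x.2 ∧ x.2 = 2 * x.1} =
      #{x : ZMod (k + k) × ZMod (k + k) | IsCoprime x.1 x.2 ∧ x.1 = 2 * x.2} := by
    convert ZMod.card_isCoprime_swap (k + k) (fun a b => a = 2 * b)
  rw [ZMod.card_isCoprime_eq_add (k + k) (by omega), h2, h3, h6, h1,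
    ZMod.card_isCoprime_mul_eq, ZMod.card_isCoprime_mul_eq]
  ring

open Finset Classical in
lemma two_mul_card_Bcon3 (v : ℕ) [NeZero v] :
    2 * Nat.card {X : Finset (ZMod v) // X ∈ Bcon3 v ∧ (0 : ZMod v) ∈ X} =
      #{x : ZMod v × ZMod v | IsCoprime x.1 x.2 ∧ DistinctDiffs x.1 x.2} := by
  rw [Nat.card_eq_fintype_card, Fintype.card_subtype, mul_comm]
  symm
  have nondeg : ∀ a b : ZMod v, DistinctDiffs a b → a ≠ 0 ∧ b ≠ 0 ∧ a ≠ b := by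
    rintro a b ⟨h1, h2, h3, -⟩
    refine ⟨?_, ?_, ?_⟩ <;> rintro rfl <;> simp at *
  have hmaps : Set.MapsTo (fun x : ZMod v × ZMod v => ({0, x.1, x.2} : Finset (ZMod v)))
      ({x | IsCoprime x.1 x.2 ∧ DistinctDiffs x.1 x.2} : Finset (ZMod v × ZMod v))
      ({X | X ∈ Bcon3 v ∧ (0 : ZMod v) ∈ X} : Finset (Finset (ZMod v))) := by
    rintro ⟨a, b⟩ h
    simp only [mem_coe, mem_filter, mem_univ, true_and] at h ⊢
    obtain ⟨ha, hb, hab⟩ := nondeg a b h.2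
    exact ⟨⟨card_eq_three.2 ⟨0, a, b, ha.symm, hb.symm, hab, rfl⟩,
      (card_sub_eq_seven_iff a b).2 h.2, (ZMod.closure_sub_eq_top_iff v a b).2 h.1⟩, by simp⟩
  rw [card_eq_sum_card_fiberwise hmaps, ← smul_eq_mul, ← sum_const]
  refine sum_congr rfl fun X hX => ?_
  simp only [mem_filter, mem_univ, true_and] at hX
  obtain ⟨⟨hX3, hX7, hXt⟩, hX0⟩ := hX
  obtain ⟨a, b, hab, hX'⟩ := card_eq_two.1 (by rw [card_erase_of_mem hX0, hX3] : #(X.erase 0) = 2)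
  obtain rfl : X = {0, a, b} := by rw [← insert_erase hX0, hX']
  have hd := (card_sub_eq_seven_iff a b).1 hX7
  have hc := (ZMod.closure_sub_eq_top_iff v a b).1 hXt
  have hd' : DistinctDiffs b a := by
    obtain ⟨h1, h2, h3, h4, h5, h6⟩ := hd
    refine ⟨h2, h1, ?_, ?_, h6, h5⟩ <;> grind
  obtain ⟨ha, hb, -⟩ := nondeg a b hd
  rw [← card_pair (a := (a, b)) (b := (b, a)) (fun h => hab (Prod.ext_iff.1 h).1)]
  congr 1
  ext ⟨c, d⟩
  simp only [mem_filter, mem_univ, true_and, mem_insert, mem_singleton, Prod.mk.injEq]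
  constructor
  · rintro ⟨⟨-, hcd⟩, h⟩
    obtain ⟨hc0, hd0, hne⟩ := nondeg c d hcd
    have m1 : c ∈ ({0, a, b} : Finset (ZMod v)) := h ▸ by simp
    have m2 : d ∈ ({0, a, b} : Finset (ZMod v)) := h ▸ by simp
    simp only [mem_insert, mem_singleton, hc0, hd0, false_or] at m1 m2
    grind
  · rintro (⟨rfl, rfl⟩ | ⟨rfl, rfl⟩)
    · exact ⟨⟨hc, hd⟩, rfl⟩
    · exact ⟨⟨isCoprime_comm.1 hc, hd'⟩, by rw [pair_comm]⟩

/-- for even `v > 4`, the number of `X ∈ B_con(v,3)` with `0 ∈ X`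
equals `φ(v)(Φ(v) - 6)/2 - 3φ(v/2)`, where `Φ(v) = v·∏_{p ∣ v} (1 + 1/p)`. -/
theorem card_base_lines_through_zero_even
    (v : ℕ) (hv : 4 < v) (heven : Even v) :
    (Nat.card {X : Finset (ZMod v) // X ∈ Bcon3 v ∧ (0 : ZMod v) ∈ X} : ℚ) =
      (Nat.totient v : ℚ) *
        ((v : ℚ) * (∏ p ∈ v.primeFactors, (1 + 1 / (p : ℚ))) - 6) / 2
      - 3 * (Nat.totient (v / 2) : ℚ) := by
  obtain ⟨k, rfl⟩ := heven
  have : NeZero (k + k) := ⟨by omega⟩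
  have h2 := two_mul_card_Bcon3 (k + k)
  have hJ := ZMod.card_isCoprime (k + k)
  rw [Nat.sq_mul_prod_one_sub_eq_totient_mul, ZMod.card_isCoprime_even k (by omega), ← h2] at hJ
  rw [show (k + k) / 2 = k by omega]
  push_cast at hJ ⊢
  linarith
end
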